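/- arXiv:1607.01839 — 5 statements merged into one kernel-verified Lean document; each statement's English description precedes it below -/
import Mathlib

section
/- Fix n ≥ 1, ν > 0 and σ ∈ (0,1/2). There exist constants C > 0 and c > 0 such that for every ℓ ∈ {0,1}, every t ≥ 0, and every ξ ∈ ℝⁿ with 0 < |ξ| ≤ ρ: |∂ₜ^ℓ 𝒥₃(t,ξ)| ≤ C e^{−c(1+t)|ξ|^{2σ}} |ξ|^{2σℓ + 2(1−2σ)} and |∂ₜ^ℓ 𝒥₄(t,ξ)| ≤ C e^{−c(1+t)|ξ|^{2σ}} |ξ|^{2σℓ − 2σ}, where ∂ₜ⁰ denotes the function itself and ∂ₜ¹ its time derivative. -/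
theorem stmt4_disc (ν σ r : ℝ) (hν : 0 < ν) (h0 : 0 < σ) (h1 : σ < 1/2) (hr : 0 < r)
    (hrρ : r ≤ (1/2) * (ν/2) ^ ((1:ℝ)/(1 - 2*σ))) :
    r ^ 2 ≤ ((1/2 : ℝ) ^ (1 - 2*σ)) ^ 2 * (ν^2/4) * (r ^ (2*σ)) ^ 2 := by
  have hp : 0 < 1 - 2*σ := by linarith
  have h2 : r ^ (1 - 2*σ) ≤ (1/2 : ℝ) ^ (1 - 2*σ) * (ν/2) := by
    calc r ^ (1 - 2*σ) ≤ ((1/2) * (ν/2) ^ ((1:ℝ)/(1 - 2*σ))) ^ (1 - 2*σ) :=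
          Real.rpow_le_rpow hr.le hrρ hp.le
      _ = (1/2 : ℝ) ^ (1 - 2*σ) * (ν/2) := by
          rw [Real.mul_rpow (by norm_num) (by positivity), ← Real.rpow_mul (by positivity),
            one_div_mul_cancel hp.ne', Real.rpow_one]
  have h3 : r = r ^ (1 - 2*σ) * r ^ (2*σ) := by
    rw [← Real.rpow_add hr]; simp
  have h4 : r ≤ (1/2 : ℝ) ^ (1 - 2*σ) * (ν/2) * r ^ (2*σ) := by
    calc r = r ^ (1 - 2*σ) * r ^ (2*σ) := h3
      _ ≤ _ := by gcongr
  calc r ^ 2 ≤ ((1/2 : ℝ) ^ (1 - 2*σ) * (ν/2) * r ^ (2*σ)) ^ 2 := by gcongr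
    _ = _ := by ring

theorem stmt4_core (ν κ A a r D lp lm t : ℝ) (hν : 0 < ν) (hκ : 0 < κ) (ha : 0 < a)
    (haA : a ≤ A) (ht : 0 ≤ t) (hD1 : κ * a ≤ D) (hD2 : D ≤ ν/2 * a)
    (hDsq : D ^ 2 = ν^2/4 * a^2 - r^2)
    (hlp : lp = -(ν/2) * a + D) (hlm : lm = -(ν/2) * a - D) :
    |lm| ≤ ν * a ∧ |lp| ≤ 2/ν * (r^2 / a) ∧
    |Real.exp (lm * t) / (lp - lm)| ≤
      Real.exp (ν/2 * A) / (2*κ) * Real.exp (-(ν/2) * (1 + t) * a) * a⁻¹ := by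
  have hD : 0 < D := lt_of_lt_of_le (by positivity) hD1
  refine ⟨?_, ?_, ?_⟩
  · rw [abs_le]; constructor <;> nlinarith [mul_pos hν ha]
  · have h1 : |lp| = ν/2*a - D := by
      rw [hlp, abs_of_nonpos (by linarith)]; ring
    have : 2/ν * (r^2 / a) = (2 * r^2) / (ν * a) := by field_simp
    rw [h1, this, le_div_iff₀ (by positivity)]
    nlinarith [mul_nonneg (sub_nonneg.2 hD2) hD.le]
  · have h1 : lp - lm = 2 * D := by rw [hlp, hlm]; ring
    rw [h1, abs_of_nonneg (by positivity)]
    have h2 : Real.exp (lm * t) ≤ Real.exp (ν/2 * A) * Real.exp (-(ν/2) * (1 + t) * a) := by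
      rw [← Real.exp_add, Real.exp_le_exp, hlm]
      nlinarith [mul_nonneg hD.le ht, mul_le_mul_of_nonneg_left haA hν.le]
    calc Real.exp (lm * t) / (2 * D)
        ≤ (Real.exp (ν/2 * A) * Real.exp (-(ν/2) * (1 + t) * a)) / (2 * (κ * a)) := by gcongr
      _ = _ := by field_simp

/-- Pointwise low-frequency estimates for the multipliers `𝒥₃` and `𝒥₄` arising from the
structurally damped wave equation with `σ ∈ (0,1/2)`, for `ℓ = 0, 1` time derivatives. -/
theorem stmt4 (n : ℕ) (hn : 1 ≤ n) (ν σ : ℝ) (hν : 0 < ν)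
    (hσ : σ ∈ Set.Ioo (0:ℝ) (1/2)) (ρ : ℝ)
    (hρ : ρ = (1/2) * (ν/2) ^ ((1:ℝ)/(1 - 2*σ)))
    (lp lm : EuclideanSpace ℝ (Fin n) → ℝ)
    (hlp : ∀ ξ, lp ξ = -(ν/2) * ‖ξ‖ ^ (2*σ) + Real.sqrt (ν^2/4 * ‖ξ‖ ^ (4*σ) - ‖ξ‖^2))
    (hlm : ∀ ξ, lm ξ = -(ν/2) * ‖ξ‖ ^ (2*σ) - Real.sqrt (ν^2/4 * ‖ξ‖ ^ (4*σ) - ‖ξ‖^2)) :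
    ∃ C > 0, ∃ c > 0, ∀ ℓ : ℕ, ℓ ≤ 1 → ∀ t : ℝ, 0 ≤ t →
      ∀ ξ : EuclideanSpace ℝ (Fin n), 0 < ‖ξ‖ → ‖ξ‖ ≤ ρ →
        |deriv^[ℓ] (fun s => lp ξ * Real.exp (lm ξ * s) / (lp ξ - lm ξ)) t|
            ≤ C * Real.exp (-c * (1 + t) * ‖ξ‖ ^ (2*σ)) * ‖ξ‖ ^ (2*σ*(ℓ:ℝ) + 2*(1 - 2*σ)) ∧
        |deriv^[ℓ] (fun s => Real.exp (lm ξ * s) / (lp ξ - lm ξ)) t|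
            ≤ C * Real.exp (-c * (1 + t) * ‖ξ‖ ^ (2*σ)) * ‖ξ‖ ^ (2*σ*(ℓ:ℝ) - 2*σ) := by
  obtain ⟨h0, h1⟩ := hσ
  have hp : 0 < 1 - 2*σ := by linarith
  set q : ℝ := (1/2 : ℝ) ^ (1 - 2*σ) with hq
  have hq0 : 0 < q := by positivity
  have hq1 : q < 1 := Real.rpow_lt_one (by norm_num) (by norm_num) hp
  have hq2 : 0 < 1 - q^2 := by nlinarith
  set κ : ℝ := ν/2 * Real.sqrt (1 - q^2) with hκd
  have hκ : 0 < κ := by have := Real.sqrt_pos.2 hq2; positivity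
  have hκ2 : κ^2 = ν^2/4 * (1 - q^2) := by
    rw [hκd, mul_pow, Real.sq_sqrt hq2.le]; ring
  set B : ℝ := Real.exp (ν/2 * ρ ^ (2*σ)) / (2*κ) with hB
  have hB0 : 0 < B := by positivity
  have hν2 : 0 < 2/ν := by positivity
  refine ⟨B * (1 + 2/ν + ν + 2), by positivity, ν/2, by positivity, ?_⟩
  intro ℓ hℓ t ht ξ hξ hξρ
  have hdisc := stmt4_disc ν σ ‖ξ‖ hν h0 h1 hξ (hρ ▸ hξρ)
  rw [← hq] at hdisc
  have haA : ‖ξ‖ ^ (2*σ) ≤ ρ ^ (2*σ) := Real.rpow_le_rpow hξ.le hξρ (by linarith)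
  have ha4 : ‖ξ‖ ^ (4*σ) = (‖ξ‖ ^ (2*σ))^2 := by
    rw [← Real.rpow_natCast, ← Real.rpow_mul hξ.le]; congr 1; push_cast; ring
  have e1 : ‖ξ‖ ^ (2*(1 - 2*σ)) = ‖ξ‖^2 / (‖ξ‖ ^ (2*σ))^2 := by
    rw [← ha4, ← Real.rpow_natCast ‖ξ‖ 2, ← Real.rpow_sub hξ]; congr 1; push_cast; ring
  have e2 : ‖ξ‖ ^ (2*σ + 2*(1 - 2*σ)) = ‖ξ‖^2 / ‖ξ‖ ^ (2*σ) := by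
    rw [← Real.rpow_natCast ‖ξ‖ 2, ← Real.rpow_sub hξ]; congr 1; push_cast; ring
  have e3 : ‖ξ‖ ^ (-(2*σ)) = (‖ξ‖ ^ (2*σ))⁻¹ := Real.rpow_neg hξ.le _
  have hlp' := hlp ξ
  have hlm' := hlm ξ
  rw [ha4] at hlp' hlm'
  have ha : 0 < ‖ξ‖ ^ (2*σ) := by positivity
  generalize ‖ξ‖ ^ (2*σ) = a at *
  have hnn : κ^2 * a^2 ≤ ν^2/4 * a^2 - ‖ξ‖^2 := by rw [hκ2]; nlinarith
  have hD1 : κ * a ≤ Real.sqrt (ν^2/4 * a^2 - ‖ξ‖^2) :=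
    Real.le_sqrt_of_sq_le (by rw [mul_pow]; exact hnn)
  have hD2 : Real.sqrt (ν^2/4 * a^2 - ‖ξ‖^2) ≤ ν/2 * a :=
    Real.sqrt_le_iff.2 ⟨by positivity, by nlinarith [sq_nonneg ‖ξ‖]⟩
  have hDsq := Real.sq_sqrt (le_trans (by positivity) hnn)
  obtain ⟨k1, k2, k3⟩ := stmt4_core ν κ (ρ ^ (2*σ)) a ‖ξ‖ _ (lp ξ) (lm ξ) t hν hκ ha haA ht
    hD1 hD2 hDsq hlp' hlm'
  rw [← hB] at k3
  set F := Real.exp (-(ν/2) * (1 + t) * a) with hF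
  have hF0 : 0 < F := Real.exp_pos _
  set r := ‖ξ‖
  set G := Real.exp (lm ξ * t) / (lp ξ - lm ξ) with hG
  have m1 : |lp ξ * G| ≤ (2/ν * (r^2/a)) * (B * F * a⁻¹) := by
    rw [abs_mul]; gcongr
  have m2 : |lm ξ * G| ≤ (ν * a) * (B * F * a⁻¹) := by
    rw [abs_mul]; gcongr
  have m3 : |lm ξ * (lp ξ * G)| ≤ (ν * a) * ((2/ν * (r^2/a)) * (B * F * a⁻¹)) := by
    rw [abs_mul]; gcongr
  have hc : ∀ x K : ℝ, 0 ≤ x → K ≤ 1 + 2/ν + ν + 2 →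
      B * K * F * x ≤ B * (1 + 2/ν + ν + 2) * F * x := by
    intro x K hx hK; gcongr
  have d4 : HasDerivAt (fun s => Real.exp (lm ξ * s) / (lp ξ - lm ξ)) (lm ξ * G) t := by
    have := (((hasDerivAt_id t).const_mul (lm ξ)).exp).div_const (lp ξ - lm ξ)
    refine HasDerivAt.congr_deriv this ?_
    rw [hG]; simp only [id]; ring
  have d3 : HasDerivAt (fun s => lp ξ * Real.exp (lm ξ * s) / (lp ξ - lm ξ))
      (lm ξ * (lp ξ * G)) t := by
    have := d4.const_mul (lp ξ)
    simp only [← mul_div_assoc] at this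
    refine HasDerivAt.congr_deriv this ?_
    ring
  interval_cases ℓ
  · simp only [Function.iterate_zero, id, Nat.cast_zero, mul_zero, zero_add, zero_sub]
    rw [e1, e3, mul_div_assoc]
    refine ⟨m1.trans (le_trans (le_of_eq ?_) (hc _ (2/ν) (by positivity) (by linarith))),
      k3.trans (le_trans (le_of_eq ?_) (hc _ 1 (by positivity) (by linarith)))⟩
    · field_simp
    · ring
  · simp only [Function.iterate_one, Nat.cast_one, mul_one, sub_self, Real.rpow_zero]
    rw [e2, d3.deriv, d4.deriv]
    refine ⟨m3.trans (le_trans (le_of_eq ?_) (hc _ 2 (by positivity) (by linarith))),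
      m2.trans (le_trans (le_of_eq ?_) ((hc 1 ν (by positivity) (by linarith)).trans_eq ?_))⟩
    · field_simp
    · field_simp
    · ring
end

section
/- Fix n ≥ 1, ν > 0, σ ∈ (0,1/2), ℓ ∈ {0,1}, real numbers k ≥ k̃ ≥ 0, and r ∈ [1,2] with conjugate exponent r' (1/r + 1/r' = 1). Then there exists C > 0 such that for every t ≥ 0 and every measurable h : ℝⁿ → ℂ: ( ∫_{0<|ξ|≤ρ} |ξ|^{2k} |∂ₜ^ℓ 𝒥₁(t,ξ)|² |h(ξ)|² dξ )^{1/2} ≤ C (1+t)^{ −(n/(2(1−σ)))(1/r − 1/2) − ℓ − (k−k̃)/(2(1−σ)) } ‖ ξ ↦ |ξ|^{k̃} h(ξ) ‖_{L^{r'}(ℝⁿ)} and ( ∫_{0<|ξ|≤ρ} |ξ|^{2k} |∂ₜ^ℓ 𝒥₃(t,ξ)|² |h(ξ)|² dξ )^{1/2} ≤ C (1+t)^{ −(n/(2σ))(1/r − 1/2) − (1−2σ)/σ − ℓ − (k−k̃)/(2σ) } ‖ ξ ↦ |ξ|^{k̃} h(ξ) ‖_{L^{r'}(ℝⁿ)}.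 -/
open MeasureTheory ENNReal

lemma aux_bound (a γ c N : ℝ) (ha : 0 < a) (hγ : 0 ≤ γ) (hc : 0 < c) (hN : 0 ≤ N) :
    ∃ M : ℝ, 0 < M ∧ ∀ x : ℝ, 0 ≤ x → x ^ γ * Real.exp (-c * x ^ a) ≤ M * (1 + x) ^ (-N) := by
  obtain ⟨m, hm⟩ := exists_nat_ge ((N + γ) / a)
  rw [div_le_iff₀ ha] at hm
  refine ⟨2 ^ (N + γ) * (1 + m.factorial / c ^ m), by positivity, fun x hx => ?_⟩
  have hE : 0 < Real.exp (c * x ^ a) := Real.exp_pos _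
  have h1 : (1 + x) ^ (N + γ) ≤ 2 ^ (N + γ) * (1 + m.factorial / c ^ m) * Real.exp (c * x ^ a) := by
    have hy : 0 ≤ c * x ^ a := by positivity
    have he1 : 1 ≤ Real.exp (c * x ^ a) := Real.one_le_exp hy
    rcases le_total x 1 with h | h
    · have : (1 + x) ^ (N + γ) ≤ 2 ^ (N + γ) :=
        Real.rpow_le_rpow (by linarith) (by linarith) (by linarith)
      have h2 : (1:ℝ) ≤ 1 + m.factorial / c ^ m := by
        have : 0 ≤ (m.factorial : ℝ) / c ^ m := by positivity
        linarith
      have h3 : (0:ℝ) ≤ 2 ^ (N + γ) := by positivity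
      calc (1 + x) ^ (N + γ) ≤ 2 ^ (N + γ) * 1 * 1 := by linarith
        _ ≤ _ := by gcongr
    · have : (1 + x) ^ (N + γ) ≤ (2 * x) ^ (N + γ) :=
        Real.rpow_le_rpow (by linarith) (by linarith) (by linarith)
      rw [Real.mul_rpow (by norm_num) hx] at this
      have h2 : x ^ (N + γ) ≤ (x ^ a) ^ m := by
        rw [← Real.rpow_natCast, ← Real.rpow_mul hx]
        exact Real.rpow_le_rpow_of_exponent_le h (by linarith)
      have h3 := Real.pow_div_factorial_le_exp _ hy m
      rw [mul_pow, div_le_iff₀ (by positivity)] at h3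
      have h4 : (x ^ a) ^ m ≤ m.factorial / c ^ m * Real.exp (c * x ^ a) := by
        rw [div_mul_eq_mul_div, le_div_iff₀ (by positivity)]; linarith
      calc (1 + x) ^ (N + γ) ≤ 2 ^ (N + γ) * x ^ (N + γ) := this
        _ ≤ 2 ^ (N + γ) * ((1 + m.factorial / c ^ m) * Real.exp (c * x ^ a)) := by
          gcongr; linarith
        _ = _ := by ring
  have h2 : x ^ γ * (1 + x) ^ N ≤ (1 + x) ^ (N + γ) := by
    rw [Real.rpow_add (by linarith), mul_comm]
    gcongr; linarith
  have h5 : 0 < (1 + x) ^ N := by positivity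
  rw [Real.rpow_neg (by linarith), neg_mul, Real.exp_neg, ← div_eq_mul_inv, ← div_eq_mul_inv,
    div_le_div_iff₀ hE h5]
  linarith

lemma aux_memLp (n : ℕ) (a γ c : ℝ) (ha : 0 < a) (hγ : 0 ≤ γ) (hc : 0 < c) (q : ℝ≥0∞) (hq : 1 ≤ q) :
    MemLp (fun x : EuclideanSpace ℝ (Fin n) => ‖x‖ ^ γ * Real.exp (-c * ‖x‖ ^ a)) q volume := by
  obtain ⟨M, hM, hb⟩ := aux_bound a γ c (n + 1) ha hγ hc (by positivity)
  have key : MemLp (fun x : EuclideanSpace ℝ (Fin n) => (1 + ‖x‖) ^ (-((n:ℝ) + 1))) q volume := by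
    by_cases hqt : q = ⊤
    · subst hqt
      refine memLp_top_of_bound (Measurable.aestronglyMeasurable (by fun_prop)) 1 (.of_forall fun x => ?_)
      rw [Real.norm_of_nonneg (by positivity)]
      exact Real.rpow_le_one_of_one_le_of_nonpos (by linarith [norm_nonneg x]) (by linarith)
    · have hq0 : q ≠ 0 := (one_pos.trans_le hq).ne'
      have hq1 : 1 ≤ q.toReal := by
        rw [← ENNReal.toReal_one]; exact (ENNReal.toReal_le_toReal (by simp) hqt).2 hq
      rw [← integrable_norm_rpow_iff (Measurable.aestronglyMeasurable (by fun_prop)) hq0 hqt]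
      have := integrable_one_add_norm (E := EuclideanSpace ℝ (Fin n)) (μ := volume)
        (r := ((n:ℝ) + 1) * q.toReal) (by simp; nlinarith)
      refine this.congr (.of_forall fun x => ?_)
      simp only
      rw [Real.norm_of_nonneg (by positivity), ← Real.rpow_mul (by positivity)]
      ring_nf
  refine MemLp.of_le (key.const_mul M) (Measurable.aestronglyMeasurable (by fun_prop)) (.of_forall fun x => ?_)
  rw [Real.norm_of_nonneg (by positivity), Real.norm_of_nonneg (by positivity)]
  exact hb _ (norm_nonneg _)

lemma aux_scale (n : ℕ) (a γ c T : ℝ) (ha : 0 < a) (hT : 0 < T) (q : ℝ≥0∞) :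
    eLpNorm (fun x : EuclideanSpace ℝ (Fin n) => ‖x‖ ^ γ * Real.exp (-c * (‖x‖ ^ a * T))) q volume
     = ENNReal.ofReal (T ^ (-(n / a) * q⁻¹.toReal - γ / a)) *
      eLpNorm (fun x : EuclideanSpace ℝ (Fin n) => ‖x‖ ^ γ * Real.exp (-c * ‖x‖ ^ a)) q volume := by
  set F := (fun x : EuclideanSpace ℝ (Fin n) => ‖x‖ ^ γ * Real.exp (-c * ‖x‖ ^ a)) with hF
  set R : ℝ := T ^ (1 / a) with hR
  have hRp : 0 < R := by positivity
  have h1 : (fun x : EuclideanSpace ℝ (Fin n) => ‖x‖ ^ γ * Real.exp (-c * (‖x‖ ^ a * T)))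
      = (T ^ (-γ / a)) • (F ∘ (R • ·)) := by
    funext x
    simp only [hF, Pi.smul_apply, Function.comp, smul_eq_mul, norm_smul, Real.norm_of_nonneg hRp.le]
    rw [Real.mul_rpow hRp.le (norm_nonneg _), Real.mul_rpow hRp.le (norm_nonneg _), hR,
      ← Real.rpow_mul hT.le, ← Real.rpow_mul hT.le, one_div_mul_cancel ha.ne', Real.rpow_one,
      mul_comm T]
    have e : T ^ (-γ / a) * T ^ (1 / a * γ) = 1 := by
      rw [← Real.rpow_add hT, show -γ / a + 1 / a * γ = 0 by ring, Real.rpow_zero]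
    rw [← mul_assoc, ← mul_assoc (T ^ (-γ / a)), ← mul_assoc (T ^ (-γ / a)), e, one_mul, mul_assoc (-c)]
  have h2 : eLpNorm (F ∘ (R • ·)) q volume
      = ENNReal.ofReal (T ^ (-(n / a) * q⁻¹.toReal)) * eLpNorm F q volume := by
    rw [← eLpNorm_map_measure (Measurable.aestronglyMeasurable (by fun_prop)) (by fun_prop),
      Measure.map_addHaar_smul _ hRp.ne', eLpNorm_smul_measure_of_ne_zero (by simp; positivity),
      smul_eq_mul, ENNReal.ofReal_rpow_of_nonneg (by positivity) (by positivity)]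
    congr 2
    rw [abs_of_nonneg (by positivity), finrank_euclideanSpace_fin, hR, ← Real.rpow_natCast,
      ← Real.rpow_mul hT.le, ← Real.rpow_neg hT.le, ← Real.rpow_mul hT.le, one_div q]
    ring_nf
  rw [h1, eLpNorm_const_smul, h2, Real.enorm_of_nonneg (by positivity), ← mul_assoc,
    ← ENNReal.ofReal_mul (by positivity), ← Real.rpow_add hT]
  congr 3
  ring

lemma aux_core (n : ℕ) (a β c ρ C0 : ℝ) (ha : 0 < a) (hβ : 0 ≤ β) (hc : 0 < c) (hρ : 0 < ρ)
    (hC0 : 0 < C0) (k ktil : ℝ) (hk : ktil ≤ k)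
    (r : ℝ) (hr : r ∈ Set.Icc (1:ℝ) 2) (r' : ℝ≥0∞)
    (hr' : 1 / ENNReal.ofReal r + 1 / r' = 1) :
    ∃ C > 0, ∀ t : ℝ, 0 ≤ t → ∀ h : EuclideanSpace ℝ (Fin n) → ℂ, Measurable h →
      ∀ m : EuclideanSpace ℝ (Fin n) → ℝ,
      (∀ ξ, 0 < ‖ξ‖ → ‖ξ‖ ≤ ρ → |m ξ| ≤ C0 * ‖ξ‖ ^ β * Real.exp (-c * ‖ξ‖ ^ a * t)) →
      (∫⁻ ξ in {ξ : EuclideanSpace ℝ (Fin n) | 0 < ‖ξ‖ ∧ ‖ξ‖ ≤ ρ},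
          ENNReal.ofReal (‖ξ‖ ^ (2*k) * |m ξ| ^ 2 * ‖h ξ‖ ^ 2)) ^ ((1:ℝ)/2)
        ≤ ENNReal.ofReal (C * (1 + t) ^ (-((n:ℝ)/a) * (1/r - 1/2) - (β + k - ktil)/a)) *
            eLpNorm (fun ξ : EuclideanSpace ℝ (Fin n) => (‖ξ‖ ^ ktil : ℝ) • h ξ) r' volume := by
  obtain ⟨hr1, hr2⟩ := hr
  have hd : 0 ≤ 1 / r - 1 / 2 := by
    rw [sub_nonneg]; exact one_div_le_one_div_of_le (by linarith) hr2
  have hd1 : 1 / r ≤ 1 := by rw [div_le_one (by linarith)]; exact hr1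
  set q : ℝ≥0∞ := (ENNReal.ofReal (1 / r - 1 / 2))⁻¹ with hq
  have hq1 : 1 ≤ q := by
    rw [hq, ENNReal.one_le_inv]
    exact ENNReal.ofReal_le_one.2 (by linarith)
  have hqt : q⁻¹.toReal = 1 / r - 1 / 2 := by
    rw [hq, inv_inv, ENNReal.toReal_ofReal hd]
  have hol : ENNReal.HolderTriple q r' 2 := by
    constructor
    rw [hq, inv_inv]
    have e1 : (1:ℝ≥0∞) / ENNReal.ofReal r = ENNReal.ofReal (1 / r - 1 / 2) + 2⁻¹ := by
      rw [show (2:ℝ≥0∞)⁻¹ = ENNReal.ofReal (1/2) by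
        rw [ENNReal.ofReal_div_of_pos (by norm_num)]; simp,
        ← ENNReal.ofReal_add hd (by norm_num), ← ENNReal.ofReal_one,
        ← ENNReal.ofReal_div_of_pos (by linarith)]
      congr 1; ring
    rw [e1, one_div r', ← ENNReal.inv_two_add_inv_two, add_right_comm] at hr'
    exact (ENNReal.add_left_inj (by simp)).1 hr'
  set F := (fun x : EuclideanSpace ℝ (Fin n) => ‖x‖ ^ (β + k - ktil) * Real.exp (-c * ‖x‖ ^ a)) with hF
  have hFm : MemLp F q volume := aux_memLp n a (β + k - ktil) c ha (by linarith) hc q hq1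
  set A := (eLpNorm F q volume).toReal with hA
  have hA0 : 0 ≤ A := ENNReal.toReal_nonneg
  set C1 := C0 * Real.exp (c * ρ ^ a) with hC1
  have hC1p : 0 < C1 := by positivity
  refine ⟨C1 * (A + 1), by positivity, fun t ht h hh m hm => ?_⟩
  set g := (fun ξ : EuclideanSpace ℝ (Fin n) => (‖ξ‖ ^ ktil : ℝ) • h ξ) with hg
  set Φ := (fun x : EuclideanSpace ℝ (Fin n) =>
    ‖x‖ ^ (β + k - ktil) * Real.exp (-c * (‖x‖ ^ a * (1 + t)))) with hΦ
  have hgm : Measurable g := by fun_prop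
  have hΦm : Measurable Φ := by fun_prop
  have hpt : ∀ ξ ∈ {ξ : EuclideanSpace ℝ (Fin n) | 0 < ‖ξ‖ ∧ ‖ξ‖ ≤ ρ},
      ENNReal.ofReal (‖ξ‖ ^ (2*k) * |m ξ| ^ 2 * ‖h ξ‖ ^ 2) ≤ ‖((C1 • Φ) • g) ξ‖ₑ ^ (2:ℝ) := by
    rintro ξ ⟨hξ0, hξ⟩
    have hm' := hm ξ hξ0 hξ
    have e1 : ‖ξ‖ ^ k * |m ξ| * ‖h ξ‖ ≤ ‖((C1 • Φ) • g) ξ‖ := by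
      simp only [hΦ, hg, Pi.smul_apply, Pi.smul_apply', smul_eq_mul, norm_smul, norm_mul]
      rw [Real.norm_of_nonneg hC1p.le, Real.norm_of_nonneg (by positivity), Real.norm_of_nonneg (by positivity), Real.norm_of_nonneg (by positivity)]
      have e2 : ‖ξ‖ ^ k * ‖ξ‖ ^ β = ‖ξ‖ ^ (β + k - ktil) * ‖ξ‖ ^ ktil := by
        rw [← Real.rpow_add hξ0, ← Real.rpow_add hξ0]; ring_nf
      have e3 : Real.exp (-c * ‖ξ‖ ^ a * t) ≤ Real.exp (c * ρ ^ a) * Real.exp (-c * (‖ξ‖ ^ a * (1 + t))) := by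
        rw [← Real.exp_add]
        apply Real.exp_le_exp.2
        have : c * ‖ξ‖ ^ a ≤ c * ρ ^ a := by gcongr
        linarith
      calc ‖ξ‖ ^ k * |m ξ| * ‖h ξ‖
          ≤ ‖ξ‖ ^ k * (C0 * ‖ξ‖ ^ β * (Real.exp (c * ρ ^ a) * Real.exp (-c * (‖ξ‖ ^ a * (1 + t))))) * ‖h ξ‖ := by
            gcongr
            exact hm'.trans (by gcongr)
        _ = C0 * (‖ξ‖ ^ k * ‖ξ‖ ^ β) * (Real.exp (c * ρ ^ a) * Real.exp (-c * (‖ξ‖ ^ a * (1 + t)))) * ‖h ξ‖ := by ring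
        _ = _ := by rw [e2, hC1]; ring
    have e4 : ‖ξ‖ ^ (2*k) * |m ξ| ^ 2 * ‖h ξ‖ ^ 2 = (‖ξ‖ ^ k * |m ξ| * ‖h ξ‖) ^ 2 := by
      rw [mul_pow, mul_pow, ← Real.rpow_natCast (‖ξ‖ ^ k), ← Real.rpow_mul hξ0.le]
      norm_num [mul_comm]
    rw [e4, ENNReal.rpow_ofNat, ENNReal.ofReal_pow (by positivity), ← ofReal_norm]
    gcongr
  have hstep : (∫⁻ ξ in {ξ : EuclideanSpace ℝ (Fin n) | 0 < ‖ξ‖ ∧ ‖ξ‖ ≤ ρ},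
          ENNReal.ofReal (‖ξ‖ ^ (2*k) * |m ξ| ^ 2 * ‖h ξ‖ ^ 2)) ^ ((1:ℝ)/2)
      ≤ eLpNorm ((C1 • Φ) • g) 2 volume := by
    rw [eLpNorm_eq_lintegral_rpow_enorm_toReal (by norm_num) (by norm_num)]
    simp only [ENNReal.toReal_ofNat]
    refine ENNReal.rpow_le_rpow ?_ (by norm_num)
    refine (setLIntegral_mono' (by measurability) hpt).trans (setLIntegral_le_lintegral _ _)
  refine hstep.trans ((eLpNorm_smul_le_mul_eLpNorm (p := q) (q := r') (r := 2)
    hgm.aestronglyMeasurable (hΦm.const_smul C1).aestronglyMeasurable).trans ?_)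
  gcongr
  rw [eLpNorm_const_smul, aux_scale n a (β + k - ktil) c (1 + t) ha (by linarith) q, hqt,
    Real.enorm_of_nonneg hC1p.le, ← ENNReal.ofReal_toReal hFm.eLpNorm_ne_top,
    ← ENNReal.ofReal_mul (by positivity), ← ENNReal.ofReal_mul (by positivity)]
  apply ENNReal.ofReal_le_ofReal
  have hP : 0 < (1 + t) ^ (-(n / a) * (1 / r - 1 / 2) - (β + k - ktil) / a) := by positivity
  change C1 * (_ * A) ≤ _
  nlinarith [mul_pos hC1p hP]

lemma aux_deriv (ℓ : ℕ) (hℓ : ℓ ≤ 1) (B l D t : ℝ) :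
    deriv^[ℓ] (fun s => B * Real.exp (l * s) / D) t = B * l ^ ℓ * Real.exp (l * t) / D := by
  interval_cases ℓ
  · simp
  · simp only [Function.iterate_one, pow_one]
    have : HasDerivAt (fun s => B * Real.exp (l * s) / D) (B * (Real.exp (l * t) * (l * 1)) / D) t :=
      ((((hasDerivAt_id t).const_mul l).exp).const_mul B).div_const D
    rw [this.deriv]; ring

/-- Elementary facts about the roots for `0 < x ≤ ρ`. -/
lemma aux_roots (ν σ : ℝ) (hν : 0 < ν) (hσ : σ ∈ Set.Ioo (0:ℝ) (1/2)) :
    ∃ κ : ℝ, 0 < κ ∧ ∀ x : ℝ, 0 < x → x ≤ (1/2) * (ν/2) ^ ((1:ℝ)/(1 - 2*σ)) →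
      κ * (ν/2 * x ^ (2*σ)) ≤ Real.sqrt (ν^2/4 * x ^ (4*σ) - x^2) ∧
      Real.sqrt (ν^2/4 * x ^ (4*σ) - x^2) ≤ ν/2 * x ^ (2*σ) ∧
      Real.sqrt (ν^2/4 * x ^ (4*σ) - x^2) ^ 2 = (ν/2 * x ^ (2*σ)) ^ 2 - x ^ 2 := by
  obtain ⟨hσ0, hσ1⟩ := hσ
  have hs : 0 < 1 - 2 * σ := by linarith
  set θ : ℝ := (1/2) ^ (1 - 2*σ) with hθ
  have hθ0 : 0 < θ := by positivity
  have hθ1 : θ < 1 := Real.rpow_lt_one (by norm_num) (by norm_num) hs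
  have hpos : 0 < 1 - θ ^ 2 := by nlinarith
  refine ⟨Real.sqrt (1 - θ ^ 2), Real.sqrt_pos.2 hpos, fun x hx hxρ => ?_⟩
  set A := ν/2 * x ^ (2*σ) with hA
  have hA0 : 0 < A := by positivity
  have hxA : x ≤ θ * A := by
    have h1 : x ^ (1 - 2*σ) ≤ θ * (ν/2) := by
      calc x ^ (1 - 2*σ) ≤ ((1/2) * (ν/2) ^ ((1:ℝ)/(1 - 2*σ))) ^ (1 - 2*σ) := by gcongr
        _ = θ * (ν/2) := by
          rw [Real.mul_rpow (by norm_num) (by positivity), ← Real.rpow_mul (by positivity),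
            one_div_mul_cancel hs.ne', Real.rpow_one]
    calc x = x ^ (1 - 2*σ) * x ^ (2*σ) := by
          rw [← Real.rpow_add hx]; simp
      _ ≤ θ * (ν/2) * x ^ (2*σ) := by gcongr
      _ = θ * A := by rw [hA]; ring
  have hAA : ν^2/4 * x ^ (4*σ) = A ^ 2 := by
    rw [hA, mul_pow, ← Real.rpow_natCast (x ^ (2*σ)), ← Real.rpow_mul hx.le]
    rw [show 2 * σ * ((2:ℕ):ℝ) = 4 * σ by push_cast; ring]; ring
  have hx2 : x ^ 2 ≤ θ ^ 2 * A ^ 2 := by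
    rw [← mul_pow]; gcongr
  rw [hAA]
  have hnn : 0 ≤ A ^ 2 - x ^ 2 := by nlinarith [mul_pos hpos (pow_pos hA0 2)]
  refine ⟨?_, ?_, Real.sq_sqrt hnn⟩
  · apply Real.le_sqrt_of_sq_le
    rw [mul_pow, Real.sq_sqrt hpos.le]; linarith
  · rw [Real.sqrt_le_left hA0.le]; nlinarith

lemma aux_final (ν σ : ℝ) (hν : 0 < ν) (hσ : σ ∈ Set.Ioo (0:ℝ) (1/2)) (ℓ : ℕ) :
    ∃ C0 : ℝ, 0 < C0 ∧ ∀ x : ℝ, 0 < x → x ≤ (1/2) * (ν/2) ^ ((1:ℝ)/(1 - 2*σ)) →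
      ∀ t : ℝ, 0 ≤ t → ∀ lp lm : ℝ,
      lp = -(ν/2) * x ^ (2*σ) + Real.sqrt (ν^2/4 * x ^ (4*σ) - x^2) →
      lm = -(ν/2) * x ^ (2*σ) - Real.sqrt (ν^2/4 * x ^ (4*σ) - x^2) →
      |-lm * lp ^ ℓ * Real.exp (lp * t) / (lp - lm)| ≤
        C0 * x ^ (2 * (1 - σ) * ℓ) * Real.exp (-(1/ν) * x ^ (2 * (1 - σ)) * t) ∧
      |lp * lm ^ ℓ * Real.exp (lm * t) / (lp - lm)| ≤
        C0 * x ^ (2 - 4 * σ + 2 * σ * ℓ) * Real.exp (-(ν/2) * x ^ (2 * σ) * t) := by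
  obtain ⟨κ, hκ, H⟩ := aux_roots ν σ hν hσ
  refine ⟨1/κ * (2/ν) ^ ℓ + 2 / (κ * ν ^ 2) * ν ^ ℓ, by positivity, ?_⟩
  intro x hx hxρ t ht lp lm hlp hlm
  obtain ⟨h1, h2, h3⟩ := H x hx hxρ
  set S := Real.sqrt (ν^2/4 * x ^ (4*σ) - x^2) with hS
  set A := ν/2 * x ^ (2*σ) with hA
  have hA0 : 0 < A := by positivity
  have hS0 : 0 < S := lt_of_lt_of_le (by positivity) h1
  have elp : lp = -(A - S) := by rw [hlp, hA]; ring
  have elm : lm = -(A + S) := by rw [hlm, hA]; ring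
  have hprod : (A - S) * (A + S) = x ^ 2 := by nlinarith
  have hX : x ^ (2 * (1 - σ)) * x ^ (2*σ) = x ^ 2 := by
    rw [← Real.rpow_add hx, ← Real.rpow_natCast]; congr 1; push_cast; ring
  have hY : x ^ 2 / A = 2 / ν * x ^ (2 * (1 - σ)) := by
    rw [← hX, hA]; field_simp
  have hup : A - S ≤ x ^ 2 / A := by
    rw [le_div_iff₀ hA0]; nlinarith
  have hlo : x ^ 2 / (2 * A) ≤ A - S := by
    rw [div_le_iff₀ (by positivity)]; nlinarith
  have hlo' : 1 / ν * x ^ (2 * (1 - σ)) ≤ A - S := by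
    refine le_trans (le_of_eq ?_) hlo
    rw [← hX, hA]; field_simp
  have hAS : 0 ≤ A - S := by linarith
  have aabs : |lp| = A - S := by rw [elp, abs_neg, abs_of_nonneg hAS]
  have babs : |lm| = A + S := by rw [elm, abs_neg, abs_of_nonneg (by linarith)]
  have dabs : |lp - lm| = 2 * S := by rw [elp, elm, abs_of_nonneg (by linarith)]; ring
  have hD : κ * (2 * A) ≤ 2 * S := by linarith
  have c1 : 0 < 1/κ * (2/ν) ^ ℓ := by positivity
  have c2 : 0 < 2 / (κ * ν ^ 2) * ν ^ ℓ := by positivity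
  constructor
  · rw [abs_div, abs_mul, abs_mul, abs_pow, abs_neg, Real.abs_exp, aabs, babs, dabs]
    have he : Real.exp (lp * t) ≤ Real.exp (-(1/ν) * x ^ (2 * (1 - σ)) * t) := by
      apply Real.exp_le_exp.2
      have := mul_le_mul_of_nonneg_right hlo' ht
      rw [elp]; linarith
    calc (A + S) * (A - S) ^ ℓ * Real.exp (lp * t) / (2 * S)
        ≤ (2 * A) * (2 / ν * x ^ (2 * (1 - σ))) ^ ℓ * Real.exp (-(1/ν) * x ^ (2 * (1 - σ)) * t) / (κ * (2 * A)) := by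
          gcongr
          · linarith
          · exact hup.trans hY.le
      _ = 1/κ * (2/ν) ^ ℓ * x ^ (2 * (1 - σ) * ℓ) * Real.exp (-(1/ν) * x ^ (2 * (1 - σ)) * t) := by
          rw [mul_pow, Real.rpow_mul hx.le (2 * (1 - σ)) ℓ, Real.rpow_natCast]
          field_simp
      _ ≤ _ := by gcongr; linarith
  · rw [abs_div, abs_mul, abs_mul, abs_pow, Real.abs_exp, aabs, babs, dabs]
    have he : Real.exp (lm * t) ≤ Real.exp (-(ν/2) * x ^ (2 * σ) * t) := by
      apply Real.exp_le_exp.2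
      have := mul_nonneg hS0.le ht
      rw [elm, neg_mul (ν / 2), ← hA]; linarith
    have hZ : 2 / ν * x ^ (2 * (1 - σ)) = 2 / ν * (x ^ (2 - 4 * σ) * x ^ (2*σ)) := by
      rw [← Real.rpow_add hx]; ring_nf
    calc (A - S) * (A + S) ^ ℓ * Real.exp (lm * t) / (2 * S)
        ≤ (2 / ν * x ^ (2 * (1 - σ))) * (2 * A) ^ ℓ * Real.exp (-(ν/2) * x ^ (2 * σ) * t) / (κ * (2 * A)) := by
          gcongr
          · exact hup.trans hY.le
          · linarith
      _ = 2 / (κ * ν ^ 2) * ν ^ ℓ * x ^ (2 - 4 * σ + 2 * σ * ℓ) * Real.exp (-(ν/2) * x ^ (2 * σ) * t) := by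
          rw [hZ, hA, show 2 * (ν / 2 * x ^ (2 * σ)) = ν * x ^ (2 * σ) by ring, mul_pow,
            Real.rpow_add hx, Real.rpow_mul hx.le (2 * σ) ℓ, Real.rpow_natCast]
          field_simp
      _ ≤ _ := by gcongr; linarith

/-- Fourier-side `L²` decay estimate for the low-frequency multipliers `𝒥₁` and `𝒥₃`
(`σ ∈ (0,1/2)`), weighted by `|ξ|^k`, against `L^{r'}` data (`1/r + 1/r' = 1`). -/
theorem stmt14 (n : ℕ) (hn : 1 ≤ n) (ν σ : ℝ) (hν : 0 < ν)
    (hσ : σ ∈ Set.Ioo (0:ℝ) (1/2)) (ℓ : ℕ) (hℓ : ℓ ≤ 1)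
    (k ktil : ℝ) (hktil : 0 ≤ ktil) (hk : ktil ≤ k)
    (r : ℝ) (hr : r ∈ Set.Icc (1:ℝ) 2) (r' : ℝ≥0∞)
    (hr' : 1 / ENNReal.ofReal r + 1 / r' = 1)
    (ρ : ℝ) (hρ : ρ = (1/2) * (ν/2) ^ ((1:ℝ)/(1 - 2*σ)))
    (lp lm : EuclideanSpace ℝ (Fin n) → ℝ)
    (hlp : ∀ ξ, lp ξ = -(ν/2) * ‖ξ‖ ^ (2*σ) + Real.sqrt (ν^2/4 * ‖ξ‖ ^ (4*σ) - ‖ξ‖^2))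
    (hlm : ∀ ξ, lm ξ = -(ν/2) * ‖ξ‖ ^ (2*σ) - Real.sqrt (ν^2/4 * ‖ξ‖ ^ (4*σ) - ‖ξ‖^2)) :
    ∃ C > 0, ∀ t : ℝ, 0 ≤ t → ∀ h : EuclideanSpace ℝ (Fin n) → ℂ, Measurable h →
      (∫⁻ ξ in {ξ : EuclideanSpace ℝ (Fin n) | 0 < ‖ξ‖ ∧ ‖ξ‖ ≤ ρ},
          ENNReal.ofReal (‖ξ‖ ^ (2*k) *
            |deriv^[ℓ] (fun s => -(lm ξ) * Real.exp (lp ξ * s) / (lp ξ - lm ξ)) t| ^ 2 *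
            ‖h ξ‖ ^ 2)) ^ ((1:ℝ)/2)
        ≤ ENNReal.ofReal (C * (1 + t) ^
              (-((n:ℝ)/(2*(1 - σ))) * (1/r - 1/2) - (ℓ:ℝ) - (k - ktil)/(2*(1 - σ)))) *
            eLpNorm (fun ξ : EuclideanSpace ℝ (Fin n) => (‖ξ‖ ^ ktil : ℝ) • h ξ) r' volume ∧
      (∫⁻ ξ in {ξ : EuclideanSpace ℝ (Fin n) | 0 < ‖ξ‖ ∧ ‖ξ‖ ≤ ρ},
          ENNReal.ofReal (‖ξ‖ ^ (2*k) *
            |deriv^[ℓ] (fun s => lp ξ * Real.exp (lm ξ * s) / (lp ξ - lm ξ)) t| ^ 2 *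
            ‖h ξ‖ ^ 2)) ^ ((1:ℝ)/2)
        ≤ ENNReal.ofReal (C * (1 + t) ^
              (-((n:ℝ)/(2*σ)) * (1/r - 1/2) - (1 - 2*σ)/σ - (ℓ:ℝ) - (k - ktil)/(2*σ))) *
            eLpNorm (fun ξ : EuclideanSpace ℝ (Fin n) => (‖ξ‖ ^ ktil : ℝ) • h ξ) r' volume := by
  obtain ⟨C0, hC0, H⟩ := aux_final ν σ hν hσ ℓ
  obtain ⟨hσ0, hσ1⟩ := hσ
  have hρ0 : 0 < ρ := by rw [hρ]; positivity
  obtain ⟨C1, hC1, H1⟩ := aux_core n (2 * (1 - σ)) (2 * (1 - σ) * ℓ) (1/ν) ρ C0 (by linarith)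
    (mul_nonneg (by linarith) (Nat.cast_nonneg _)) (by positivity) hρ0 hC0 k ktil hk r hr r' hr'
  obtain ⟨C2, hC2, H2⟩ := aux_core n (2 * σ) (2 - 4 * σ + 2 * σ * ℓ) (ν/2) ρ C0 (by linarith)
    (add_nonneg (by linarith) (by positivity)) (by positivity) hρ0 hC0 k ktil hk r hr r' hr'
  refine ⟨C1 + C2, by positivity, fun t ht h hh => ⟨?_, ?_⟩⟩
  · refine (H1 t ht h hh _ fun ξ h0 h1 => ?_).trans ?_
    · rw [aux_deriv ℓ hℓ]
      exact (H ‖ξ‖ h0 (hρ ▸ h1) t ht (lp ξ) (lm ξ) (hlp ξ) (hlm ξ)).1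
    · have e : -((n:ℝ)/(2*(1 - σ))) * (1/r - 1/2) - (2 * (1 - σ) * ℓ + k - ktil)/(2*(1 - σ))
          = -((n:ℝ)/(2*(1 - σ))) * (1/r - 1/2) - (ℓ:ℝ) - (k - ktil)/(2*(1 - σ)) := by
        have : 1 - σ ≠ 0 := by linarith
        field_simp
        ring
      rw [e]
      gcongr
      linarith
  · refine (H2 t ht h hh _ fun ξ h0 h1 => ?_).trans ?_
    · rw [aux_deriv ℓ hℓ]
      exact (H ‖ξ‖ h0 (hρ ▸ h1) t ht (lp ξ) (lm ξ) (hlp ξ) (hlm ξ)).2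
    · have e : -((n:ℝ)/(2*σ)) * (1/r - 1/2) - (2 - 4 * σ + 2 * σ * ℓ + k - ktil)/(2*σ)
          = -((n:ℝ)/(2*σ)) * (1/r - 1/2) - (1 - 2*σ)/σ - (ℓ:ℝ) - (k - ktil)/(2*σ) := by
        have : σ ≠ 0 := by linarith
        field_simp
        ring
      rw [e]
      gcongr
      linarith
end

section
/- Fix n ≥ 2, ν > 0, σ ∈ (0,1/2), ℓ ∈ {0,1}, and real numbers k ≥ k̃ ≥ 0. Then there exists C > 0 such that for every t ≥ 0 and every bounded measurable h : ℝⁿ → ℂ: ( ∫_{0<|ξ|≤ρ} |ξ|^{2k} |∂ₜ^ℓ 𝒥₂(t,ξ)|² |h(ξ)|² dξ )^{1/2} ≤ C (1+t)^{ −n/(4(1−σ)) + σ/(1−σ) − ℓ − (k−k̃)/(2(1−σ)) } · sup_{ξ≠0} |ξ|^{k̃}|h(ξ)| and ( ∫_{0<|ξ|≤ρ} |ξ|^{2k} |∂ₜ^ℓ 𝒥₄(t,ξ)|² |h(ξ)|² dξ )^{1/2} ≤ C (1+t)^{ −n/(4σ) + 1 − ℓ − (k−k̃)/(2σ) } ·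 sup_{ξ≠0} |ξ|^{k̃}|h(ξ)|. -/
open MeasureTheory ENNReal

lemma radial_bound (n : ℕ) (hn : 2 ≤ n) (α b c : ℝ) (hα : -(n:ℝ) < α) (hb : 0 < b) (hc : 0 < c) :
    ∃ K > 0, ∀ s : ℝ, 0 < s →
      ∫⁻ ξ : EuclideanSpace ℝ (Fin n), ENNReal.ofReal (‖ξ‖ ^ α * Real.exp (-(c * s) * ‖ξ‖ ^ b))
        ≤ ENNReal.ofReal (K * s ^ (-(n + α) / b)) := by
  haveI : Nonempty (Fin n) := ⟨⟨0, by omega⟩⟩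
  haveI : Nontrivial (EuclideanSpace ℝ (Fin n)) := inferInstance
  set V : ℝ := (volume : Measure (EuclideanSpace ℝ (Fin n))).real (Metric.ball 0 1) with hV
  have hV0 : 0 ≤ V := measureReal_nonneg
  have hG : 0 < Real.Gamma ((n + α) / b) := Real.Gamma_pos_of_pos (div_pos (by linarith) hb)
  set K0 : ℝ := n * (V * (c ^ (-(n + α) / b) * (1 / b) * Real.Gamma ((n + α) / b))) with hK0
  have hK0' : 0 ≤ K0 := by positivity
  refine ⟨K0 + 1, by positivity, fun s hs => ?_⟩
  have hcs : 0 < c * s := mul_pos hc hs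
  have hq : -1 < (n:ℝ) - 1 + α := by linarith
  have key : ∀ y ∈ Set.Ioi (0:ℝ), y ^ ((n:ℝ) - 1 + α) * Real.exp (-(c * s) * y ^ b)
      = y ^ (n - 1) • (y ^ α * Real.exp (-(c * s) * y ^ b)) := by
    intro y hy
    have hy' : 0 < y := hy
    rw [Real.rpow_add hy', smul_eq_mul, ← mul_assoc]
    congr 2
    rw [← Real.rpow_natCast, Nat.cast_sub (by omega)]
    simp
  have hint1 := integrableOn_rpow_mul_exp_neg_mul_rpow (s := (n:ℝ) - 1 + α) hq hb hcs
  have hint2 : Integrable (fun ξ : EuclideanSpace ℝ (Fin n) =>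
      ‖ξ‖ ^ α * Real.exp (-(c * s) * ‖ξ‖ ^ b)) := by
    have := (integrable_fun_norm_addHaar (volume : Measure (EuclideanSpace ℝ (Fin n)))
      (f := fun y : ℝ => y ^ α * Real.exp (-(c * s) * y ^ b)))
    rw [this]
    rw [finrank_euclideanSpace_fin]
    exact hint1.congr_fun key measurableSet_Ioi
  rw [← ofReal_integral_eq_lintegral_ofReal hint2 (Filter.Eventually.of_forall fun ξ => by positivity)]
  apply ENNReal.ofReal_le_ofReal
  rw [integral_fun_norm_addHaar (volume : Measure (EuclideanSpace ℝ (Fin n)))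
      (fun y : ℝ => y ^ α * Real.exp (-(c * s) * y ^ b)), finrank_euclideanSpace_fin,
      ← setIntegral_congr_fun measurableSet_Ioi key,
      integral_rpow_mul_exp_neg_mul_rpow hb hq hcs]
  have e1 : (n:ℝ) - 1 + α + 1 = n + α := by ring
  rw [e1, Real.mul_rpow hc.le hs.le, nsmul_eq_mul, smul_eq_mul, ← hV]
  have hs' : 0 ≤ s ^ (-(n + α) / b) := by positivity
  calc _ = K0 * s ^ (-(n + α) / b) := by rw [hK0]; ring
    _ ≤ _ := by nlinarith

lemma core_bound (n : ℕ) (hn : 2 ≤ n) (σ : ℝ) (hσ : σ < 1 / 2) (ℓ : ℕ) (hℓ : ℓ ≤ 1)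
    (k ktil : ℝ) (hk : ktil ≤ k) (ρ : ℝ) (hρ : 0 < ρ) (b : ℝ) (hb : 0 < b)
    (c1 c2 δ : ℝ) (hc1 : 0 < c1) (hc2 : 0 < c2) (hδ : 0 < δ)
    (lam d : EuclideanSpace ℝ (Fin n) → ℝ)
    (h1 : ∀ ξ, 0 < ‖ξ‖ → ‖ξ‖ ≤ ρ → lam ξ ≤ -(c1 * ‖ξ‖ ^ b))
    (h2 : ∀ ξ, 0 < ‖ξ‖ → ‖ξ‖ ≤ ρ → -(c2 * ‖ξ‖ ^ b) ≤ lam ξ)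
    (h3 : ∀ ξ, 0 < ‖ξ‖ → ‖ξ‖ ≤ ρ → δ * ‖ξ‖ ^ (2 * σ) ≤ d ξ)
    (E : ℝ) (hE : 2 * E = -(n + (2 * (k - ktil) + 2 * b * ℓ - 4 * σ)) / b) :
    ∃ C > 0, ∀ t : ℝ, 0 ≤ t → ∀ h : EuclideanSpace ℝ (Fin n) → ℂ,
      ∀ M : ℝ, 0 ≤ M → (∀ ξ : EuclideanSpace ℝ (Fin n), ξ ≠ 0 → ‖ξ‖ ^ ktil * ‖h ξ‖ ≤ M) →
      (∫⁻ ξ in {ξ : EuclideanSpace ℝ (Fin n) | 0 < ‖ξ‖ ∧ ‖ξ‖ ≤ ρ},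
          ENNReal.ofReal (‖ξ‖ ^ (2*k) *
            |deriv^[ℓ] (fun s => Real.exp (lam ξ * s) / d ξ) t| ^ 2 *
            ‖h ξ‖ ^ 2)) ^ ((1:ℝ)/2)
        ≤ ENNReal.ofReal (C * (1 + t) ^ E * M) := by
  set α : ℝ := 2 * (k - ktil) + 2 * b * ℓ - 4 * σ with hαdef
  have hn' : (2:ℝ) ≤ n := by exact_mod_cast hn
  have hα : -(n:ℝ) < α := by
    have : 0 ≤ 2 * b * (ℓ:ℝ) := by positivity
    rw [hαdef]; linarith
  obtain ⟨K, hK, hKb⟩ := radial_bound n hn α b (2 * c1) hα hb (by positivity)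
  set B : ℝ := (c2 ^ ℓ / δ) ^ 2 * Real.exp (2 * c1 * ρ ^ b) with hB
  have hBpos : 0 < B := by positivity
  refine ⟨Real.sqrt (B * K), by positivity, fun t ht h M hM hh => ?_⟩
  have hs : 0 < 1 + t := by linarith
  have hmeas : MeasurableSet {ξ : EuclideanSpace ℝ (Fin n) | 0 < ‖ξ‖ ∧ ‖ξ‖ ≤ ρ} :=
    (measurableSet_lt measurable_const measurable_norm).inter
      (measurableSet_le measurable_norm measurable_const)
  have hderiv : ∀ l e : ℝ, deriv^[ℓ] (fun s => Real.exp (l * s) / e) t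
      = l ^ ℓ * Real.exp (l * t) / e := by
    intro l e
    interval_cases ℓ
    · simp
    · have : HasDerivAt (fun s => Real.exp (l * s) / e) (Real.exp (l * t) * (l * 1) / e) t :=
        (((hasDerivAt_id t).const_mul l).exp).div_const e
      simp only [Function.iterate_one, this.deriv]
      ring
  have hpt : ∀ ξ ∈ {ξ : EuclideanSpace ℝ (Fin n) | 0 < ‖ξ‖ ∧ ‖ξ‖ ≤ ρ},
      ENNReal.ofReal (‖ξ‖ ^ (2*k) *
            |deriv^[ℓ] (fun s => Real.exp (lam ξ * s) / d ξ) t| ^ 2 * ‖h ξ‖ ^ 2)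
      ≤ ENNReal.ofReal (B * M ^ 2) *
        ENNReal.ofReal (‖ξ‖ ^ α * Real.exp (-(2 * c1 * (1 + t)) * ‖ξ‖ ^ b)) := by
    rintro ξ ⟨hr0, hrρ⟩
    rw [← ENNReal.ofReal_mul (by positivity)]
    apply ENNReal.ofReal_le_ofReal
    rw [hderiv]
    have g1 := h1 ξ hr0 hrρ
    have g2 := h2 ξ hr0 hrρ
    have g3 := h3 ξ hr0 hrρ
    have g4 := hh ξ (norm_pos_iff.mp hr0)
    set r := ‖ξ‖ with hr
    have hrb : 0 < r ^ b := by positivity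
    have hrs : 0 < r ^ (2 * σ) := by positivity
    have habs : |lam ξ| ≤ c2 * r ^ b := by
      rw [abs_le]; exact ⟨g2, by nlinarith [mul_pos hc1 hrb, mul_pos hc2 hrb]⟩
    have hexp : Real.exp (lam ξ * t) ≤ Real.exp (c1 * ρ ^ b) * Real.exp (-(c1 * (1 + t)) * r ^ b) := by
      rw [← Real.exp_add]
      apply Real.exp_le_exp.mpr
      have : r ^ b ≤ ρ ^ b := Real.rpow_le_rpow hr0.le hrρ hb.le
      nlinarith [mul_le_mul_of_nonneg_right g1 ht, mul_le_mul_of_nonneg_left this hc1.le]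
    have hdpos : 0 < d ξ := lt_of_lt_of_le (by positivity) g3
    have hJ : |lam ξ ^ ℓ * Real.exp (lam ξ * t) / d ξ|
        ≤ (c2 * r ^ b) ^ ℓ * (Real.exp (c1 * ρ ^ b) * Real.exp (-(c1 * (1 + t)) * r ^ b)) /
          (δ * r ^ (2 * σ)) := by
      rw [abs_div, abs_mul, abs_pow, abs_of_pos hdpos, abs_of_pos (Real.exp_pos _)]
      gcongr
    have hH : r ^ (2 * k) * ‖h ξ‖ ^ 2 ≤ r ^ (2 * (k - ktil)) * M ^ 2 := by
      have e : r ^ (2 * k) = r ^ (2 * (k - ktil)) * (r ^ ktil) ^ 2 := by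
        rw [← Real.rpow_natCast, ← Real.rpow_mul hr0.le, ← Real.rpow_add hr0]
        congr 1; push_cast; ring
      rw [e, mul_assoc, ← mul_pow]
      gcongr
    calc r ^ (2 * k) * |lam ξ ^ ℓ * Real.exp (lam ξ * t) / d ξ| ^ 2 * ‖h ξ‖ ^ 2
        = (r ^ (2 * k) * ‖h ξ‖ ^ 2) * |lam ξ ^ ℓ * Real.exp (lam ξ * t) / d ξ| ^ 2 := by ring
      _ ≤ (r ^ (2 * (k - ktil)) * M ^ 2) * ((c2 * r ^ b) ^ ℓ *
          (Real.exp (c1 * ρ ^ b) * Real.exp (-(c1 * (1 + t)) * r ^ b)) /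
          (δ * r ^ (2 * σ))) ^ 2 := by gcongr
      _ = B * M ^ 2 * (r ^ α * Real.exp (-(2 * c1 * (1 + t)) * r ^ b)) := by
        have e1 : r ^ α = r ^ (2 * (k - ktil)) * ((r ^ b) ^ ℓ) ^ 2 / (r ^ (2 * σ)) ^ 2 := by
          rw [← Real.rpow_natCast (r ^ b), ← Real.rpow_natCast, ← Real.rpow_natCast (r ^ (2 * σ)),
            ← Real.rpow_mul hr0.le, ← Real.rpow_mul hr0.le, ← Real.rpow_mul hr0.le,
            ← Real.rpow_add hr0, ← Real.rpow_sub hr0]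
          congr 1; rw [hαdef]; push_cast; ring
        have e2 : Real.exp (-(2 * c1 * (1 + t)) * r ^ b)
            = Real.exp (-(c1 * (1 + t)) * r ^ b) ^ 2 := by
          rw [← Real.exp_nat_mul]; congr 1; push_cast; ring
        have e3 : Real.exp (2 * c1 * ρ ^ b) = Real.exp (c1 * ρ ^ b) ^ 2 := by
          rw [← Real.exp_nat_mul]; congr 1; push_cast; ring
        rw [e1, e2, hB, e3, mul_pow]
        field_simp
  have hle : (∫⁻ ξ in {ξ : EuclideanSpace ℝ (Fin n) | 0 < ‖ξ‖ ∧ ‖ξ‖ ≤ ρ},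
          ENNReal.ofReal (‖ξ‖ ^ (2*k) *
            |deriv^[ℓ] (fun s => Real.exp (lam ξ * s) / d ξ) t| ^ 2 *
            ‖h ξ‖ ^ 2)) ≤ ENNReal.ofReal (B * M ^ 2 * (K * (1 + t) ^ (2 * E))) := by
    refine (setLIntegral_mono' hmeas hpt).trans ?_
    refine (setLIntegral_le_lintegral _ _).trans ?_
    rw [lintegral_const_mul' _ _ ENNReal.ofReal_ne_top,
      ENNReal.ofReal_mul (p := B * M ^ 2) (by positivity), hE]
    exact mul_le_mul_right (hKb (1 + t) hs) _
  refine (ENNReal.rpow_le_rpow hle (by norm_num)).trans ?_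
  rw [ENNReal.ofReal_rpow_of_nonneg (by positivity) (by norm_num)]
  apply le_of_eq
  congr 1
  rw [← Real.sqrt_eq_rpow]
  have : B * M ^ 2 * (K * (1 + t) ^ (2 * E)) = (B * K) * ((1 + t) ^ E * M) ^ 2 := by
    rw [mul_comm 2 E, Real.rpow_mul hs.le]
    norm_cast
    ring
  rw [this, Real.sqrt_mul (by positivity), Real.sqrt_sq (by positivity)]
  ring

/-- Fourier-side `L²` decay estimate for the low-frequency multipliers `𝒥₂` and `𝒥₄`
(`σ ∈ (0,1/2)`), weighted by `|ξ|^k`, against bounded data (the `r = 1` case, where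
`sup_{ξ≠0} |ξ|^k̃ |h(ξ)| ≤ M`). -/
theorem stmt15 (n : ℕ) (hn : 2 ≤ n) (ν σ : ℝ) (hν : 0 < ν)
    (hσ : σ ∈ Set.Ioo (0:ℝ) (1/2)) (ℓ : ℕ) (hℓ : ℓ ≤ 1)
    (k ktil : ℝ) (hktil : 0 ≤ ktil) (hk : ktil ≤ k)
    (ρ : ℝ) (hρ : ρ = (1/2) * (ν/2) ^ ((1:ℝ)/(1 - 2*σ)))
    (lp lm : EuclideanSpace ℝ (Fin n) → ℝ)
    (hlp : ∀ ξ, lp ξ = -(ν/2) * ‖ξ‖ ^ (2*σ) + Real.sqrt (ν^2/4 * ‖ξ‖ ^ (4*σ) - ‖ξ‖^2))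
    (hlm : ∀ ξ, lm ξ = -(ν/2) * ‖ξ‖ ^ (2*σ) - Real.sqrt (ν^2/4 * ‖ξ‖ ^ (4*σ) - ‖ξ‖^2)) :
    ∃ C > 0, ∀ t : ℝ, 0 ≤ t → ∀ h : EuclideanSpace ℝ (Fin n) → ℂ, Measurable h →
      ∀ M : ℝ, (∀ ξ : EuclideanSpace ℝ (Fin n), ξ ≠ 0 → ‖ξ‖ ^ ktil * ‖h ξ‖ ≤ M) →
      (∫⁻ ξ in {ξ : EuclideanSpace ℝ (Fin n) | 0 < ‖ξ‖ ∧ ‖ξ‖ ≤ ρ},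
          ENNReal.ofReal (‖ξ‖ ^ (2*k) *
            |deriv^[ℓ] (fun s => Real.exp (lp ξ * s) / (lp ξ - lm ξ)) t| ^ 2 *
            ‖h ξ‖ ^ 2)) ^ ((1:ℝ)/2)
        ≤ ENNReal.ofReal (C * (1 + t) ^
              (-(n:ℝ)/(4*(1 - σ)) + σ/(1 - σ) - (ℓ:ℝ) - (k - ktil)/(2*(1 - σ))) * M) ∧
      (∫⁻ ξ in {ξ : EuclideanSpace ℝ (Fin n) | 0 < ‖ξ‖ ∧ ‖ξ‖ ≤ ρ},
          ENNReal.ofReal (‖ξ‖ ^ (2*k) *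
            |deriv^[ℓ] (fun s => Real.exp (lm ξ * s) / (lp ξ - lm ξ)) t| ^ 2 *
            ‖h ξ‖ ^ 2)) ^ ((1:ℝ)/2)
        ≤ ENNReal.ofReal (C * (1 + t) ^
              (-(n:ℝ)/(4*σ) + 1 - (ℓ:ℝ) - (k - ktil)/(2*σ)) * M) := by
  obtain ⟨hσ0, hσ1⟩ := hσ
  have hρ0 : 0 < ρ := by rw [hρ]; positivity
  set q : ℝ := (1/2 : ℝ) ^ (2 - 4 * σ) with hq
  have hq1 : q < 1 := Real.rpow_lt_one (by norm_num) (by norm_num) (by linarith)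
  set δ : ℝ := Real.sqrt (1 - q) * (ν / 2) with hδ
  have hδ0 : 0 < δ := mul_pos (Real.sqrt_pos.mpr (by linarith)) (by positivity)
  have hρq : ρ ^ (2 - 4 * σ) = q * (ν / 2) ^ 2 := by
    rw [hρ, Real.mul_rpow (by norm_num) (by positivity), ← Real.rpow_mul (by positivity)]
    congr 1
    rw [← Real.rpow_natCast]
    congr 1
    have : 1 - 2 * σ ≠ 0 := by linarith
    push_cast
    field_simp
    ring
  have basic : ∀ r : ℝ, 0 < r → r ≤ ρ →
      0 ≤ ν^2/4 * r ^ (4*σ) - r^2 ∧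
      δ * r ^ (2*σ) ≤ Real.sqrt (ν^2/4 * r ^ (4*σ) - r^2) ∧
      Real.sqrt (ν^2/4 * r ^ (4*σ) - r^2) ≤ ν / 2 * r ^ (2*σ) := by
    intro r hr hrρ
    have e4 : r ^ (4*σ) = (r ^ (2*σ)) ^ 2 := by
      rw [← Real.rpow_natCast, ← Real.rpow_mul hr.le]; congr 1; push_cast; ring
    have e2 : r ^ 2 = r ^ (2 - 4*σ) * r ^ (4*σ) := by
      rw [← Real.rpow_add hr, ← Real.rpow_natCast]; congr 1; push_cast; ring
    have hle : r ^ (2 - 4*σ) ≤ q * (ν / 2) ^ 2 :=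
      hρq ▸ Real.rpow_le_rpow hr.le hrρ (by linarith)
    have hp4 : 0 < r ^ (4*σ) := by positivity
    have hlow : (δ * r ^ (2*σ)) ^ 2 ≤ ν^2/4 * r ^ (4*σ) - r^2 := by
      rw [mul_pow, ← e4, hδ, mul_pow, Real.sq_sqrt (by linarith), e2]
      nlinarith [mul_le_mul_of_nonneg_right hle hp4.le]
    refine ⟨(sq_nonneg _).trans hlow, Real.le_sqrt_of_sq_le hlow, ?_⟩
    apply Real.sqrt_le_iff.mpr
    refine ⟨by positivity, ?_⟩
    rw [mul_pow, ← e4]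
    nlinarith [sq_nonneg r]
  have hd : ∀ ξ, 0 < ‖ξ‖ → ‖ξ‖ ≤ ρ → (2 * δ) * ‖ξ‖ ^ (2 * σ) ≤ lp ξ - lm ξ := by
    intro ξ h0 h1
    obtain ⟨_, b2, _⟩ := basic _ h0 h1
    rw [hlp, hlm]; linarith
  have hm1 : ∀ ξ, 0 < ‖ξ‖ → ‖ξ‖ ≤ ρ → lm ξ ≤ -(ν / 2 * ‖ξ‖ ^ (2 * σ)) := by
    intro ξ h0 h1
    rw [hlm]; linarith [Real.sqrt_nonneg (ν^2/4 * ‖ξ‖ ^ (4*σ) - ‖ξ‖^2)]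
  have hm2 : ∀ ξ, 0 < ‖ξ‖ → ‖ξ‖ ≤ ρ → -(ν * ‖ξ‖ ^ (2 * σ)) ≤ lm ξ := by
    intro ξ h0 h1
    obtain ⟨_, _, b3⟩ := basic _ h0 h1
    rw [hlm]; linarith
  have hprod : ∀ ξ, 0 < ‖ξ‖ → ‖ξ‖ ≤ ρ → (-lp ξ) * (-lm ξ) =
      ‖ξ‖ ^ (2 * (1 - σ)) * ‖ξ‖ ^ (2 * σ) := by
    intro ξ h0 h1
    obtain ⟨b1, _, _⟩ := basic _ h0 h1
    have e4 : ‖ξ‖ ^ (4*σ) = (‖ξ‖ ^ (2*σ)) ^ 2 := by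
      rw [← Real.rpow_natCast, ← Real.rpow_mul h0.le]; congr 1; push_cast; ring
    have e2 : ‖ξ‖ ^ (2 * (1 - σ)) * ‖ξ‖ ^ (2 * σ) = ‖ξ‖ ^ 2 := by
      rw [← Real.rpow_add h0, ← Real.rpow_natCast]; congr 1; push_cast; ring
    rw [e2, hlp, hlm]
    have := Real.sq_sqrt b1
    rw [e4] at this ⊢
    linear_combination -this
  have hlpneg : ∀ ξ, 0 < ‖ξ‖ → ‖ξ‖ ≤ ρ → 0 ≤ -lp ξ := by
    intro ξ h0 h1
    obtain ⟨_, _, b3⟩ := basic _ h0 h1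
    rw [hlp]; linarith
  have hp1 : ∀ ξ, 0 < ‖ξ‖ → ‖ξ‖ ≤ ρ → lp ξ ≤ -(1 / ν * ‖ξ‖ ^ (2 * (1 - σ))) := by
    intro ξ h0 h1
    have a := hprod ξ h0 h1
    have a2 := hm2 ξ h0 h1
    have a3 := hlpneg ξ h0 h1
    have hp : 0 < ‖ξ‖ ^ (2 * σ) := by positivity
    have : ‖ξ‖ ^ (2 * (1 - σ)) ≤ (-lp ξ) * ν := by
      refine le_of_mul_le_mul_right ?_ hp
      nlinarith
    have : 1 / ν * ‖ξ‖ ^ (2 * (1 - σ)) ≤ -lp ξ := by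
      rw [one_div_mul_eq_div, div_le_iff₀ hν]; exact this
    linarith
  have hp2 : ∀ ξ, 0 < ‖ξ‖ → ‖ξ‖ ≤ ρ → -(2 / ν * ‖ξ‖ ^ (2 * (1 - σ))) ≤ lp ξ := by
    intro ξ h0 h1
    have a := hprod ξ h0 h1
    have a2 := hm1 ξ h0 h1
    have a3 := hlpneg ξ h0 h1
    have hp : 0 < ‖ξ‖ ^ (2 * σ) := by positivity
    have : (-lp ξ) * ν ≤ 2 * ‖ξ‖ ^ (2 * (1 - σ)) := by
      refine le_of_mul_le_mul_right ?_ hp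
      nlinarith
    have : -lp ξ ≤ 2 / ν * ‖ξ‖ ^ (2 * (1 - σ)) := by
      rw [div_mul_eq_mul_div, le_div_iff₀ hν]; exact this
    linarith
  have hσ' : (1 - σ) ≠ 0 := by linarith
  obtain ⟨C1, hC1, H1⟩ := core_bound n hn σ hσ1 ℓ hℓ k ktil hk ρ hρ0 (2 * (1 - σ)) (by linarith)
    (1 / ν) (2 / ν) (2 * δ) (by positivity) (by positivity) (by positivity) lp
    (fun ξ => lp ξ - lm ξ) hp1 hp2 hd
    (-(n:ℝ)/(4*(1 - σ)) + σ/(1 - σ) - (ℓ:ℝ) - (k - ktil)/(2*(1 - σ))) (by field_simp; ring)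
  obtain ⟨C2, hC2, H2⟩ := core_bound n hn σ hσ1 ℓ hℓ k ktil hk ρ hρ0 (2 * σ) (by linarith)
    (ν / 2) ν (2 * δ) (by positivity) (by positivity) (by positivity) lm
    (fun ξ => lp ξ - lm ξ) hm1 hm2 hd
    (-(n:ℝ)/(4*σ) + 1 - (ℓ:ℝ) - (k - ktil)/(2*σ)) (by field_simp; ring)
  refine ⟨C1 + C2, by positivity, fun t ht h _ M hM => ?_⟩
  haveI : Nonempty (Fin n) := ⟨⟨0, by omega⟩⟩
  obtain ⟨ξ₀, hξ₀⟩ := exists_ne (0 : EuclideanSpace ℝ (Fin n))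
  have hM0 : 0 ≤ M := le_trans (by positivity) (hM ξ₀ hξ₀)
  have ht' : 0 < 1 + t := by linarith
  refine ⟨(H1 t ht h M hM0 hM).trans ?_, (H2 t ht h M hM0 hM).trans ?_⟩
  · apply ENNReal.ofReal_le_ofReal
    gcongr
    linarith
  · apply ENNReal.ofReal_le_ofReal
    gcongr
    linarith
end

section
/- Fix n ≥ 1, ν > 0, σ ∈ (1/2,1], ℓ ∈ {0,1}, real numbers k and k̃ with k + ℓ ≥ k̃ ≥ 0 and k ≥ 0, and r ∈ [1,2] with conjugate exponent r' (1/r + 1/r' = 1). Then there exists C > 0 such that for every t ≥ 0 and every measurable h : ℝⁿ → ℂ: ( ∫_{0<|ξ|≤ρ} |ξ|^{2k} |∂ₜ^ℓ 𝒦₁(t,ξ)|² |h(ξ)|² dξ )^{1/2} ≤ C (1+t)^{ −(n/(2σ))(1/r − 1/2) − (ℓ + k − k̃)/(2σ) } ‖ ξ ↦ |ξ|^{k̃} h(ξ) ‖_{L^{r'}(ℝⁿ)} and ( ∫_{0<|ξ|≤ρ} |ξ|^{2k} |∂ₜ^ℓ 𝒦₂(t,ξ)|² |h(ξ)|² dξ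 )^{1/2} ≤ C (1+t)^{ −(n/(2σ))(1/r − 1/2) − (ℓ + k − k̃ + 1)/(2σ) } ‖ ξ ↦ |ξ|^{k̃} h(ξ) ‖_{L^{r'}(ℝⁿ)}. -/
open MeasureTheory ENNReal

lemma exp_bound (c b : ℝ) (hc : 0 < c) : ∃ D > 0, ∀ y : ℝ, 1 ≤ y → y ^ b * Real.exp (-(c * y)) ≤ D := by
  obtain ⟨N, hN⟩ := exists_nat_ge b
  refine ⟨(N.factorial : ℝ) / c ^ N, by positivity, fun y hy => ?_⟩
  have h1 : y ^ b ≤ y ^ N := by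
    rw [← Real.rpow_natCast]
    exact Real.rpow_le_rpow_of_exponent_le hy hN
  have h2 := Real.pow_div_factorial_le_exp (c * y) (by positivity) N
  rw [Real.exp_neg, ← div_eq_mul_inv, div_le_iff₀ (Real.exp_pos _)]
  refine h1.trans ?_
  rw [div_le_iff₀ (by positivity), mul_pow] at h2
  rw [div_mul_eq_mul_div, le_div_iff₀ (by positivity)]
  linarith

lemma G_bound (c a m p : ℝ) (hc : 0 < c) (ha : 0 ≤ a) (hp : 1 ≤ p) :
    ∃ D > 0, ∀ s : ℝ, 0 ≤ s → s ^ a * Real.exp (-(c * s ^ p)) ≤ D * (1 + s) ^ (-m) := by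
  obtain ⟨D, hD, h⟩ := exp_bound c (a + m) hc
  refine ⟨D * Real.exp (2 * c), by positivity, fun s hs => ?_⟩
  have h1 : s ≤ s ^ p + 1 := by
    rcases le_total s 1 with h | h
    · have := Real.rpow_nonneg hs p
      linarith
    · have := Real.rpow_le_rpow_of_exponent_le h hp
      rw [Real.rpow_one] at this
      linarith
  have h2 : s ^ a ≤ (1 + s) ^ a := Real.rpow_le_rpow hs (by linarith) ha
  have h3 : Real.exp (-(c * s ^ p)) ≤ Real.exp (2 * c) * Real.exp (-(c * (1 + s))) := by
    rw [← Real.exp_add]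
    apply Real.exp_le_exp.2
    nlinarith
  have h4 := h (1 + s) (by linarith)
  have hpos : 0 < 1 + s := by linarith
  calc s ^ a * Real.exp (-(c * s ^ p)) ≤ (1 + s) ^ a * (Real.exp (2 * c) * Real.exp (-(c * (1 + s)))) := by
        gcongr
    _ = Real.exp (2 * c) * ((1 + s) ^ (a + m) * Real.exp (-(c * (1 + s)))) * (1 + s) ^ (-m) := by
        rw [Real.rpow_add hpos, Real.rpow_neg hpos.le]
        field_simp
    _ ≤ Real.exp (2 * c) * D * (1 + s) ^ (-m) := by gcongr
    _ = _ := by ring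

lemma J_memLp (n : ℕ) (q : ℝ≥0∞) (hq : 1 ≤ q) :
    eLpNorm (fun x : EuclideanSpace ℝ (Fin n) => (1 + ‖x‖) ^ (-((n:ℝ) + 1))) q volume < ∞ := by
  have hJ1 : ∀ x : EuclideanSpace ℝ (Fin n), (1 + ‖x‖) ^ (-((n:ℝ) + 1)) ≤ 1 := fun x =>
    Real.rpow_le_one_of_one_le_of_nonpos (by linarith [norm_nonneg x]) (by linarith [Nat.cast_nonneg (α := ℝ) n])
  have hJ0 : ∀ x : EuclideanSpace ℝ (Fin n), 0 ≤ (1 + ‖x‖) ^ (-((n:ℝ) + 1)) := fun x => by positivity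
  have hJe : ∀ x : EuclideanSpace ℝ (Fin n), ‖(1 + ‖x‖) ^ (-((n:ℝ) + 1))‖ₑ ≤ 1 := fun x => by
    rw [Real.enorm_of_nonneg (hJ0 x)]
    exact ENNReal.ofReal_le_one.2 (hJ1 x)
  by_cases hq' : q = ∞
  · subst hq'
    rw [eLpNorm_exponent_top]
    refine lt_of_le_of_lt (eLpNormEssSup_le_of_ae_enorm_bound (C := 1) (.of_forall hJe)) (by simp)
  · have hq0 : q ≠ 0 := by rintro rfl; simp at hq
    rw [eLpNorm_lt_top_iff_lintegral_rpow_enorm_lt_top hq0 hq']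
    have hi := (integrable_one_add_norm (E := EuclideanSpace ℝ (Fin n)) (μ := volume) (r := (n:ℝ) + 1) (by simp)).2
    refine lt_of_le_of_lt (lintegral_mono fun x => ?_) hi
    have h1 : 1 ≤ q.toReal := by
      have := ENNReal.toReal_mono hq' hq
      simpa using this
    simpa using ENNReal.rpow_le_rpow_of_exponent_ge (hJe x) h1

lemma scale (n : ℕ) (f : EuclideanSpace ℝ (Fin n) → ℝ) (hf : Measurable f) (q : ℝ≥0∞) (l : ℝ) (hl : 0 < l) :
    eLpNorm (fun x => f (l • x)) q volume = ENNReal.ofReal (l ^ (-(n:ℝ) * (q⁻¹).toReal)) * eLpNorm f q volume := by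
  have h1 := eLpNorm_map_measure (μ := (volume : Measure (EuclideanSpace ℝ (Fin n)))) (p := q) (f := fun x => l • x)
    (g := f) hf.aestronglyMeasurable (by fun_prop)
  rw [Measure.map_addHaar_smul _ hl.ne', eLpNorm_smul_measure_of_ne_zero (by simp; positivity)] at h1
  change _ = eLpNorm (fun x => f (l • x)) q volume at h1
  rw [← h1, smul_eq_mul]
  congr 1
  rw [abs_of_pos (by positivity), ENNReal.ofReal_rpow_of_pos (by positivity)]
  congr 1
  simp only [finrank_euclideanSpace, Fintype.card_fin, one_div]
  rw [← Real.rpow_natCast, ← Real.rpow_neg hl.le, ← Real.rpow_mul hl.le]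

lemma key (n : ℕ) (c σ a ρ e : ℝ) (hc : 0 < c) (hσ : 1/2 < σ) (ha : 0 ≤ a) (he : 0 ≤ e) (he1 : e ≤ 1 / 2)
    (r' : ℝ≥0∞) (hq : ENNReal.ofReal e + r'⁻¹ = 2⁻¹) (A : ℝ) (hA : 0 < A) :
    ∃ C > 0, ∀ t : ℝ, 0 ≤ t → ∀ g : EuclideanSpace ℝ (Fin n) → ℂ, Measurable g →
      ∀ F : EuclideanSpace ℝ (Fin n) → ℝ,
      (∀ ξ, 0 < ‖ξ‖ → ‖ξ‖ ≤ ρ → F ξ ≤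
        (A * (‖ξ‖ ^ a * Real.exp (-(c * t * ‖ξ‖ ^ (2*σ)))) * ‖g ξ‖) ^ 2) →
      (∫⁻ ξ in {ξ : EuclideanSpace ℝ (Fin n) | 0 < ‖ξ‖ ∧ ‖ξ‖ ≤ ρ},
          ENNReal.ofReal (F ξ)) ^ ((1:ℝ)/2)
        ≤ ENNReal.ofReal (C * (1 + t) ^ (-((n:ℝ)/(2*σ)) * e - a/(2*σ))) * eLpNorm g r' volume := by
  obtain ⟨D, hD, hG⟩ := G_bound c a ((n:ℝ)+1) (2*σ) hc ha (by linarith)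
  set q : ℝ≥0∞ := (ENNReal.ofReal e)⁻¹ with hqdef
  have hq1 : 1 ≤ q := by
    rw [hqdef, ENNReal.one_le_inv]
    exact ENNReal.ofReal_le_one.2 (by linarith)
  have hJ := J_memLp n q hq1
  set J : EuclideanSpace ℝ (Fin n) → ℝ := fun x => (1 + ‖x‖) ^ (-((n:ℝ) + 1)) with hJdef
  have hJm : Measurable J := by fun_prop
  set N := (eLpNorm J q volume).toReal with hN
  have hN0 : 0 ≤ N := ENNReal.toReal_nonneg
  have hNe : eLpNorm J q volume = ENNReal.ofReal N := (ENNReal.ofReal_toReal hJ.ne).symm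
  set B := A * Real.exp (c * ρ ^ (2*σ)) * D with hB
  have hBpos : 0 < B := by positivity
  refine ⟨B * (N + 1), by positivity, fun t ht g hg F hF => ?_⟩
  have hT : 0 < 1 + t := by linarith
  have hσ0 : 0 < 2 * σ := by linarith
  set l := (1 + t) ^ (1 / (2*σ)) with hl
  have hlpos : 0 < l := by positivity
  set K := B * (1+t) ^ (-(a/(2*σ))) with hK
  have hKpos : 0 < K := by positivity
  have hpt : ∀ ξ, 0 < ‖ξ‖ → ‖ξ‖ ≤ ρ → F ξ ≤ ‖(K * J (l • ξ)) • g ξ‖ ^ 2 := by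
    intro ξ h0 h1
    refine (hF ξ h0 h1).trans ?_
    have hJ0 : 0 ≤ J (l • ξ) := by simp only [hJdef]; positivity
    rw [norm_smul, Real.norm_of_nonneg (by positivity)]
    refine pow_le_pow_left₀ (by positivity) (mul_le_mul_of_nonneg_right ?_ (norm_nonneg _)) 2
    have hGs := hG (l * ‖ξ‖) (by positivity)
    have hJeq : J (l • ξ) = (1 + l * ‖ξ‖) ^ (-((n:ℝ) + 1)) := by
      simp only [hJdef]; rw [norm_smul, Real.norm_of_nonneg hlpos.le]
    rw [← hJeq, Real.mul_rpow hlpos.le h0.le, Real.mul_rpow hlpos.le h0.le, hl, ← Real.rpow_mul hT.le,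
      ← Real.rpow_mul hT.le, one_div_mul_cancel hσ0.ne', Real.rpow_one] at hGs
    have hx : ‖ξ‖ ^ (2*σ) ≤ ρ ^ (2*σ) := by gcongr
    have hexp : Real.exp (-(c * t * ‖ξ‖ ^ (2*σ))) ≤
        Real.exp (c * ρ ^ (2*σ)) * Real.exp (-(c * ((1 + t) * ‖ξ‖ ^ (2*σ)))) := by
      rw [← Real.exp_add]
      apply Real.exp_le_exp.2
      nlinarith
    have hTa : (1+t) ^ (-(a/(2*σ))) * (1+t) ^ (1/(2*σ) * a) = 1 := by
      rw [← Real.rpow_add hT]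
      convert Real.rpow_zero _ using 2
      ring
    calc A * (‖ξ‖ ^ a * Real.exp (-(c * t * ‖ξ‖ ^ (2*σ))))
        ≤ A * (‖ξ‖ ^ a * (Real.exp (c * ρ ^ (2*σ)) * Real.exp (-(c * ((1 + t) * ‖ξ‖ ^ (2*σ)))))) := by gcongr
      _ = ((1+t) ^ (-(a/(2*σ))) * (1+t) ^ (1/(2*σ) * a)) * (A * (‖ξ‖ ^ a * (Real.exp (c * ρ ^ (2*σ)) * Real.exp (-(c * ((1 + t) * ‖ξ‖ ^ (2*σ))))))) := by
          rw [hTa, one_mul]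
      _ = A * Real.exp (c * ρ ^ (2*σ)) * (1+t) ^ (-(a/(2*σ))) *
          ((1+t) ^ (1/(2*σ) * a) * ‖ξ‖ ^ a * Real.exp (-(c * ((1 + t) * ‖ξ‖ ^ (2*σ))))) := by ring
      _ ≤ A * Real.exp (c * ρ ^ (2*σ)) * (1+t) ^ (-(a/(2*σ))) * (D * J (l • ξ)) := by gcongr
      _ = K * J (l • ξ) := by rw [hK, hB]; ring
  have hS : MeasurableSet {ξ : EuclideanSpace ℝ (Fin n) | 0 < ‖ξ‖ ∧ ‖ξ‖ ≤ ρ} :=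
    (measurableSet_lt measurable_const measurable_norm).inter (measurableSet_le measurable_norm measurable_const)
  have : ENNReal.HolderTriple q r' 2 := ⟨by rw [hqdef, inv_inv, hq]⟩
  have hm : Measurable (fun ξ => K * J (l • ξ)) := by fun_prop
  have hH := eLpNorm_smul_le_mul_eLpNorm (p := q) (q := r') (r := 2) (μ := volume)
    (f := g) (φ := fun ξ => K * J (l • ξ)) hg.aestronglyMeasurable hm.aestronglyMeasurable
  have h2 : (∫⁻ ξ in {ξ : EuclideanSpace ℝ (Fin n) | 0 < ‖ξ‖ ∧ ‖ξ‖ ≤ ρ},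
          ENNReal.ofReal (F ξ)) ^ ((1:ℝ)/2) ≤ eLpNorm ((fun ξ => K * J (l • ξ)) • g) 2 volume := by
    rw [eLpNorm_eq_lintegral_rpow_enorm_toReal (by simp) (by simp)]
    simp only [ENNReal.toReal_ofNat, Pi.smul_apply', ENNReal.rpow_ofNat]
    refine ENNReal.rpow_le_rpow ?_ (by norm_num)
    refine le_trans ?_ (setLIntegral_le_lintegral {ξ : EuclideanSpace ℝ (Fin n) | 0 < ‖ξ‖ ∧ ‖ξ‖ ≤ ρ} _)
    refine setLIntegral_mono' hS fun ξ hξ => ?_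
    rw [← ofReal_norm, ← ENNReal.ofReal_pow (norm_nonneg _)]
    exact ENNReal.ofReal_le_ofReal (hpt ξ hξ.1 hξ.2)
  refine (h2.trans hH).trans ?_
  gcongr
  have h3 : (fun ξ => K * J (l • ξ)) = K • (fun ξ => J (l • ξ)) := by ext; simp
  rw [h3, eLpNorm_const_smul, scale n J hJm q l hlpos, hNe, Real.enorm_of_nonneg hKpos.le,
    ← ENNReal.ofReal_mul (by positivity), ← ENNReal.ofReal_mul (by positivity)]
  apply ENNReal.ofReal_le_ofReal
  have h4 : l ^ (-(n:ℝ) * (q⁻¹).toReal) = (1+t) ^ (-((n:ℝ)/(2*σ)) * e) := by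
    rw [hqdef, inv_inv, ENNReal.toReal_ofReal he, hl, ← Real.rpow_mul hT.le]
    congr 1
    field_simp
  rw [h4, sub_eq_add_neg, Real.rpow_add hT, hK]
  have : 0 < (1+t) ^ (-((n:ℝ)/(2*σ)) * e) * (1+t) ^ (-(a/(2*σ))) := by positivity
  nlinarith [mul_pos hBpos this]

lemma K1_bound (ℓ : ℕ) (hℓ : ℓ ≤ 1) (b x X p P t : ℝ) (hb : 0 ≤ b) (hx : 0 < x) (hX : 0 ≤ X)
    (hXP : X ≤ P * x) (hP : 0 ≤ P) (hp : 0 ≤ p) (hp1 : p ≤ 1) :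
    |deriv^[ℓ] (fun s => Real.exp (-b * s * X) * Real.cos (s * x * p)) t| ≤
      (1 + b * P) * x ^ ℓ * Real.exp (-(b * t * X)) := by
  have he : Real.exp (-b * t * X) = Real.exp (-(b * t * X)) := by congr 1; ring
  have hbP : 0 ≤ b * P := by positivity
  interval_cases ℓ
  · simp only [Function.iterate_zero, id, pow_zero, mul_one]
    rw [abs_mul, Real.abs_exp, he, mul_comm]
    gcongr
    linarith [Real.abs_cos_le_one (t * x * p)]
  · have hd : HasDerivAt (fun s => Real.exp (-b * s * X) * Real.cos (s * x * p))
        (Real.exp (-b * t * X) * (-b * 1 * X) * Real.cos (t * x * p) +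
          Real.exp (-b * t * X) * (-Real.sin (t * x * p) * (1 * x * p))) t := by
      apply HasDerivAt.mul
      · exact (((hasDerivAt_id t).const_mul (-b)).mul_const X).exp
      · exact (((hasDerivAt_id t).mul_const x).mul_const p).cos
    simp only [Function.iterate_one, pow_one]
    rw [hd.deriv, he]
    have h1 := Real.abs_cos_le_one (t * x * p)
    have h2 := Real.abs_sin_le_one (t * x * p)
    have : Real.exp (-(b * t * X)) * (-b * 1 * X) * Real.cos (t * x * p) +
          Real.exp (-(b * t * X)) * (-Real.sin (t * x * p) * (1 * x * p)) =
        -(b * X * Real.cos (t * x * p) + x * p * Real.sin (t * x * p)) * Real.exp (-(b * t * X)) := by ring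
    rw [this, abs_mul, Real.abs_exp, abs_neg]
    gcongr
    calc _ ≤ |b * X * Real.cos (t * x * p)| + |x * p * Real.sin (t * x * p)| := abs_add_le _ _
      _ = b * X * |Real.cos (t * x * p)| + x * p * |Real.sin (t * x * p)| := by
        rw [abs_mul, abs_mul (x * p), abs_of_nonneg (by positivity : 0 ≤ b * X),
          abs_of_nonneg (by positivity : 0 ≤ x * p)]
      _ ≤ b * (P * x) * 1 + x * 1 * 1 := by gcongr
      _ = _ := by ring

lemma K2_bound (ℓ : ℕ) (hℓ : ℓ ≤ 1) (b ν N x X p P t : ℝ) (hb : 0 ≤ b) (hx : 0 < x) (hX : 0 ≤ X)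
    (hXP : X ≤ P * x) (hP : 0 ≤ P) (hp : 0 < p) (hp1 : p ≤ 1) (hν : 0 < ν) (hN : ν / (2 * p) ≤ N) :
    |deriv^[ℓ] (fun s => Real.exp (-b * s * X) * ν * x * Real.sin (s * x * p) / (2 * p)) t| ≤
      N * (1 + b * P) * x ^ (ℓ + 1) * Real.exp (-(b * t * X)) := by
  have he : Real.exp (-b * t * X) = Real.exp (-(b * t * X)) := by congr 1; ring
  have hbP : 0 ≤ b * P := by positivity
  have hfun : (fun s => Real.exp (-b * s * X) * ν * x * Real.sin (s * x * p) / (2 * p)) =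
      fun s => (ν / (2 * p) * x) * (Real.exp (-b * s * X) * Real.sin (s * x * p)) := by
    ext s; ring
  have hN0 : 0 ≤ N := le_trans (by positivity) hN
  have h1 := Real.abs_cos_le_one (t * x * p)
  have h2 := Real.abs_sin_le_one (t * x * p)
  rw [hfun]
  interval_cases ℓ
  · simp only [Function.iterate_zero, id, zero_add, pow_one]
    rw [abs_mul, abs_mul (Real.exp _), Real.abs_exp, he, abs_of_nonneg (by positivity : 0 ≤ ν / (2 * p) * x)]
    calc _ ≤ (N * x) * (Real.exp (-(b * t * X)) * (1 + b * P)) := by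
          gcongr
          linarith
      _ = _ := by ring
  · have hd : HasDerivAt (fun s => (ν / (2 * p) * x) * (Real.exp (-b * s * X) * Real.sin (s * x * p)))
        ((ν / (2 * p) * x) * (Real.exp (-b * t * X) * (-b * 1 * X) * Real.sin (t * x * p) +
          Real.exp (-b * t * X) * (Real.cos (t * x * p) * (1 * x * p)))) t := by
      apply HasDerivAt.const_mul
      apply HasDerivAt.mul
      · exact (((hasDerivAt_id t).const_mul (-b)).mul_const X).exp
      · exact (((hasDerivAt_id t).mul_const x).mul_const p).sin
    simp only [Function.iterate_one]
    rw [hd.deriv, he]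
    have : Real.exp (-(b * t * X)) * (-b * 1 * X) * Real.sin (t * x * p) +
          Real.exp (-(b * t * X)) * (Real.cos (t * x * p) * (1 * x * p)) =
        (x * p * Real.cos (t * x * p) - b * X * Real.sin (t * x * p)) * Real.exp (-(b * t * X)) := by ring
    rw [this, abs_mul, abs_mul _ (Real.exp _), Real.abs_exp, abs_of_nonneg (by positivity : 0 ≤ ν / (2 * p) * x)]
    have h3 : |x * p * Real.cos (t * x * p) - b * X * Real.sin (t * x * p)| ≤ (1 + b * P) * x := by
      calc _ ≤ |x * p * Real.cos (t * x * p)| + |b * X * Real.sin (t * x * p)| := abs_sub _ _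
        _ = x * p * |Real.cos (t * x * p)| + b * X * |Real.sin (t * x * p)| := by
          rw [abs_mul, abs_mul (b * X), abs_of_nonneg (by positivity : 0 ≤ b * X),
            abs_of_nonneg (by positivity : 0 ≤ x * p)]
        _ ≤ x * 1 * 1 + b * (P * x) * 1 := by gcongr
        _ = _ := by ring
    calc _ ≤ (N * x) * (((1 + b * P) * x) * Real.exp (-(b * t * X))) := by gcongr
      _ = _ := by ring

lemma sq_bound (x k kt A d E H w : ℝ) (j : ℕ) (hx : 0 < x) (hA : 0 ≤ A) (hE : 0 ≤ E) (hH : 0 ≤ H)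
    (hw : w = x ^ kt * H) (hd : |d| ≤ A * x ^ j * E) :
    x ^ (2 * k) * |d| ^ 2 * H ^ 2 ≤ (A * (x ^ ((j:ℝ) + k - kt) * E) * w) ^ 2 := by
  have h1 : x ^ (2 * k) = (x ^ k) ^ 2 := by
    rw [← Real.rpow_natCast, ← Real.rpow_mul hx.le]; congr 1; push_cast; ring
  rw [h1, ← mul_pow, ← mul_pow]
  refine pow_le_pow_left₀ (by positivity) ?_ 2
  calc x ^ k * |d| * H ≤ x ^ k * (A * x ^ j * E) * H := by gcongr
    _ = _ := by
      rw [hw, Real.rpow_sub hx, Real.rpow_add hx, Real.rpow_natCast]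
      have := (Real.rpow_pos_of_pos hx kt).ne'
      field_simp

/-- Fourier-side `L²` decay estimate for the low-frequency multipliers `𝒦₁` and `𝒦₂`
(`σ ∈ (1/2,1]`), weighted by `|ξ|^k`, against `L^{r'}` data (`1/r + 1/r' = 1`). -/
theorem stmt16 (n : ℕ) (hn : 1 ≤ n) (ν σ : ℝ) (hν : 0 < ν)
    (hσ : σ ∈ Set.Ioc (1/2 : ℝ) 1) (ℓ : ℕ) (hℓ : ℓ ≤ 1)
    (k ktil : ℝ) (hk0 : 0 ≤ k) (hktil : 0 ≤ ktil) (hk : ktil ≤ k + ℓ)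
    (r : ℝ) (hr : r ∈ Set.Icc (1:ℝ) 2) (r' : ℝ≥0∞)
    (hr' : 1 / ENNReal.ofReal r + 1 / r' = 1)
    (ρ : ℝ) (hρ : ρ = (1/2) * (2/ν) ^ ((1:ℝ)/(2*σ - 1)))
    (φ : EuclideanSpace ℝ (Fin n) → ℝ)
    (hφ : ∀ ξ, φ ξ = Real.sqrt (1 - ν^2/4 * ‖ξ‖ ^ (4*σ - 2))) :
    ∃ C > 0, ∀ t : ℝ, 0 ≤ t → ∀ h : EuclideanSpace ℝ (Fin n) → ℂ, Measurable h →
      (∫⁻ ξ in {ξ : EuclideanSpace ℝ (Fin n) | 0 < ‖ξ‖ ∧ ‖ξ‖ ≤ ρ},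
          ENNReal.ofReal (‖ξ‖ ^ (2*k) *
            |deriv^[ℓ] (fun s => Real.exp (-(ν/2) * s * ‖ξ‖ ^ (2*σ)) *
                Real.cos (s * ‖ξ‖ * φ ξ)) t| ^ 2 * ‖h ξ‖ ^ 2)) ^ ((1:ℝ)/2)
        ≤ ENNReal.ofReal (C * (1 + t) ^
              (-((n:ℝ)/(2*σ)) * (1/r - 1/2) - ((ℓ:ℝ) + k - ktil)/(2*σ))) *
            eLpNorm (fun ξ : EuclideanSpace ℝ (Fin n) => (‖ξ‖ ^ ktil : ℝ) • h ξ) r' volume ∧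
      (∫⁻ ξ in {ξ : EuclideanSpace ℝ (Fin n) | 0 < ‖ξ‖ ∧ ‖ξ‖ ≤ ρ},
          ENNReal.ofReal (‖ξ‖ ^ (2*k) *
            |deriv^[ℓ] (fun s => Real.exp (-(ν/2) * s * ‖ξ‖ ^ (2*σ)) * ν * ‖ξ‖ *
                Real.sin (s * ‖ξ‖ * φ ξ) / (2 * φ ξ)) t| ^ 2 * ‖h ξ‖ ^ 2)) ^ ((1:ℝ)/2)
        ≤ ENNReal.ofReal (C * (1 + t) ^
              (-((n:ℝ)/(2*σ)) * (1/r - 1/2) - ((ℓ:ℝ) + k - ktil + 1)/(2*σ))) *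
            eLpNorm (fun ξ : EuclideanSpace ℝ (Fin n) => (‖ξ‖ ^ ktil : ℝ) • h ξ) r' volume := by
  have hσ1 := hσ.1
  have hσ2 := hσ.2
  have hσm : 0 < 2 * σ - 1 := by linarith
  have hr1 := hr.1
  have hr2 := hr.2
  have hr0 : 0 < r := by linarith
  have he : 0 ≤ 1 / r - 1 / 2 := by
    rw [sub_nonneg]; exact one_div_le_one_div_of_le hr0 hr2
  have he1 : 1 / r - 1 / 2 ≤ 1 / 2 := by
    have : 1 / r ≤ 1 := by rw [div_le_one hr0]; exact hr1
    linarith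
  have hq : ENNReal.ofReal (1 / r - 1 / 2) + r'⁻¹ = 2⁻¹ := by
    have h2 : ENNReal.ofReal (1 / 2) = 2⁻¹ := by
      rw [one_div, ENNReal.ofReal_inv_of_pos (by norm_num)]; simp
    have h1 : 1 / ENNReal.ofReal r = 2⁻¹ + ENNReal.ofReal (1 / r - 1 / 2) := by
      rw [← h2, ← ENNReal.ofReal_add (by norm_num) he, one_div, ← ENNReal.ofReal_inv_of_pos hr0]
      congr 1; ring
    rw [h1, one_div r', add_assoc] at hr'
    have h3 : (2⁻¹ : ℝ≥0∞) + 2⁻¹ = 1 := ENNReal.inv_two_add_inv_two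
    rw [← h3] at hr'
    exact (ENNReal.add_right_inj (a := 2⁻¹) (by simp)).1 hr'
  have hρ0 : 0 < ρ := by rw [hρ]; positivity
  set θ : ℝ := (1 / 2) ^ (4 * σ - 2) with hθ
  have hθ1 : θ < 1 := Real.rpow_lt_one (by norm_num) (by norm_num) (by linarith)
  have hρθ : ν ^ 2 / 4 * ρ ^ (4 * σ - 2) = θ := by
    rw [hρ, Real.mul_rpow (by norm_num) (by positivity), ← Real.rpow_mul (by positivity)]
    have : 1 / (2 * σ - 1) * (4 * σ - 2) = (2 : ℕ) := by
      rw [div_mul_eq_mul_div, div_eq_iff hσm.ne']; push_cast; ring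
    rw [this, Real.rpow_natCast, ← hθ]
    field_simp
    ring
  set p0 := Real.sqrt (1 - θ) with hp0
  have hp0pos : 0 < p0 := Real.sqrt_pos.2 (by linarith)
  have hφ1 : ∀ ξ, φ ξ ≤ 1 := fun ξ => by
    rw [hφ, Real.sqrt_le_one]
    have : 0 ≤ ν^2/4 * ‖ξ‖ ^ (4*σ - 2) := by positivity
    linarith
  have hφ0 : ∀ ξ, ‖ξ‖ ≤ ρ → p0 ≤ φ ξ := fun ξ hξ => by
    rw [hφ, hp0]
    apply Real.sqrt_le_sqrt
    have : ‖ξ‖ ^ (4 * σ - 2) ≤ ρ ^ (4 * σ - 2) :=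
      Real.rpow_le_rpow (norm_nonneg _) hξ (by linarith)
    have : ν ^ 2 / 4 * ‖ξ‖ ^ (4 * σ - 2) ≤ ν ^ 2 / 4 * ρ ^ (4 * σ - 2) := by gcongr
    linarith
  set P := ρ ^ (2 * σ - 1) with hP
  have hP0 : 0 < P := by positivity
  have hXP : ∀ ξ : EuclideanSpace ℝ (Fin n), 0 < ‖ξ‖ → ‖ξ‖ ≤ ρ → ‖ξ‖ ^ (2 * σ) ≤ P * ‖ξ‖ := by
    intro ξ h0 h1
    have : ‖ξ‖ ^ (2 * σ) = ‖ξ‖ ^ (2 * σ - 1) * ‖ξ‖ := by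
      rw [← Real.rpow_add_one h0.ne']; congr 1; ring
    rw [this]
    exact mul_le_mul_of_nonneg_right (Real.rpow_le_rpow h0.le h1 hσm.le) h0.le
  have hA1 : 0 < 1 + ν / 2 * P := by positivity
  have hA2 : 0 < ν / (2 * p0) * (1 + ν / 2 * P) := by positivity
  obtain ⟨C1, hC1, H1⟩ := key n (ν/2) σ ((ℓ:ℝ) + k - ktil) ρ (1/r - 1/2) (by positivity) hσ1 (by linarith)
    he he1 r' hq _ hA1
  obtain ⟨C2, hC2, H2⟩ := key n (ν/2) σ ((ℓ:ℝ) + k - ktil + 1) ρ (1/r - 1/2) (by positivity) hσ1 (by linarith)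
    he he1 r' hq _ hA2
  refine ⟨max C1 C2, lt_max_of_lt_left hC1, fun t ht h hh => ?_⟩
  have hg : Measurable (fun ξ : EuclideanSpace ℝ (Fin n) => (‖ξ‖ ^ ktil : ℝ) • h ξ) :=
    (measurable_norm.pow_const ktil).smul hh
  have hgn : ∀ ξ, ‖(‖ξ‖ ^ ktil : ℝ) • h ξ‖ = ‖ξ‖ ^ ktil * ‖h ξ‖ := fun ξ => by
    rw [norm_smul, Real.norm_of_nonneg (by positivity)]
  have hT : 0 < 1 + t := by linarith
  constructor
  · refine (H1 t ht _ hg _ fun ξ h0 h1 => ?_).trans (b := _) ?_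
    rotate_left
    · gcongr
      exact le_max_left _ _
    · exact sq_bound _ _ _ _ _ _ _ _ ℓ h0 hA1.le (Real.exp_pos _).le (norm_nonneg _) (hgn ξ)
        (K1_bound ℓ hℓ _ _ _ _ P t (by positivity) h0 (by positivity) (hXP ξ h0 h1) hP0.le
          (hp0pos.le.trans (hφ0 ξ h1)) (hφ1 ξ))
  · refine (H2 t ht _ hg _ fun ξ h0 h1 => ?_).trans (b := _) ?_
    rotate_left
    · gcongr
      exact le_max_right _ _
    · have hN : ν / (2 * φ ξ) ≤ ν / (2 * p0) := by
        have := hφ0 ξ h1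
        gcongr
      have := sq_bound _ k _ _ _ _ _ _ (ℓ+1) h0 hA2.le (Real.exp_pos _).le (norm_nonneg _) (hgn ξ)
        (K2_bound ℓ hℓ (ν/2) ν _ _ _ _ P t (by positivity) h0 (by positivity) (hXP ξ h0 h1) hP0.le
          (hp0pos.trans_le (hφ0 ξ h1)) (hφ1 ξ) hν hN)
      have hj : ((ℓ + 1 : ℕ) : ℝ) + k - ktil = (ℓ:ℝ) + k - ktil + 1 := by push_cast; ring
      rw [hj] at this
      exact this
end

section
/- Fix n ≥ 3, ν > 0, σ ∈ (1/2,1], ℓ ∈ {0,1}, and real numbers k and k̃ with k + ℓ ≥ k̃ ≥ 0 and k ≥ 0. Then there exists C > 0 such that for every t ≥ 0 and every bounded measurable h : ℝⁿ → ℂ: ( ∫_{0<|ξ|≤ρ} |ξ|^{2k} |∂ₜ^ℓ 𝒦₃(t,ξ)|² |h(ξ)|² dξ )^{1/2} ≤ C (1+t)^{ −n/(4σ) − (ℓ + k − k̃ − 1)/(2σ) } · sup_{ξ≠0} |ξ|^{k̃}|h(ξ)|. -/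
open MeasureTheory ENNReal

lemma aux_deriv_s17 (ν q r p t : ℝ) (hr : 0 < r) (hp : 0 < p) :
    deriv (fun s => Real.exp (-(ν/2) * s * q) * Real.sin (s * r * p) / (r * p)) t
      = Real.exp (-(ν/2) * t * q) * (Real.cos (t * r * p) - (ν/2) * q / (r * p) * Real.sin (t * r * p)) := by
  have h1 : HasDerivAt (fun s : ℝ => -(ν/2) * s * q) (-(ν/2) * 1 * q) t :=
    ((hasDerivAt_id t).const_mul _).mul_const _
  have h2 : HasDerivAt (fun s : ℝ => s * r * p) (1 * r * p) t :=
    ((hasDerivAt_id t).mul_const _).mul_const _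
  have h3 := (h1.exp.mul h2.sin).div_const (r * p)
  refine h3.deriv.trans ?_
  field_simp
  ring

lemma aux_bound_s17 (ν σ r ρ p p0 t : ℝ) (hν : 0 < ν) (hσ : 1/2 < σ) (hr : 0 < r) (hrρ : r ≤ ρ)
    (hp0 : 0 < p0) (hp : p0 ≤ p) (ℓ : ℕ) (hℓ : ℓ ≤ 1) :
    |deriv^[ℓ] (fun s => Real.exp (-(ν/2) * s * r ^ (2*σ)) *
                Real.sin (s * r * p) / (r * p)) t|
      ≤ (1 + (1 + (ν/2) * ρ ^ (2*σ-1)) / p0) * (Real.exp (-(ν/2) * t * r ^ (2*σ)) * r ^ ((ℓ:ℝ) - 1)) := by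
  have hpp : 0 < p := hp0.trans_le hp
  have hρ : 0 < ρ := hr.trans_le hrρ
  have hq : 0 ≤ ρ ^ (2*σ-1) := by positivity
  have hinv : 1 / p ≤ 1 / p0 := one_div_le_one_div_of_le hp0 hp
  have hp1 : 0 < 1 / p := by positivity
  have hν2 : 0 ≤ (ν/2) * ρ ^ (2*σ-1) := by positivity
  have hexp := Real.exp_pos (-(ν/2) * t * r ^ (2*σ))
  set E := Real.exp (-(ν/2) * t * r ^ (2*σ)) with hE
  obtain rfl | rfl : ℓ = 0 ∨ ℓ = 1 := by omega
  · simp only [Function.iterate_zero, id, Nat.cast_zero, zero_sub, Real.rpow_neg_one]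
    rw [← hE]
    rw [abs_div, abs_mul, abs_of_pos hexp, abs_of_pos (mul_pos hr hpp)]
    have hs := Real.abs_sin_le_one (t * r * p)
    calc E * |Real.sin (t * r * p)| / (r * p) ≤ E * 1 / (r * p) := by gcongr
      _ = (1 / p) * (E * r⁻¹) := by field_simp
      _ ≤ _ := by
        gcongr
        rw [add_div]
        have : 0 ≤ (ν/2) * ρ ^ (2*σ-1) / p0 := by positivity
        linarith
  · simp only [Function.iterate_one, Nat.cast_one, sub_self, Real.rpow_zero, mul_one]
    rw [aux_deriv_s17 ν _ r p t hr hpp, ← hE, abs_mul, abs_of_pos hexp, mul_comm]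
    gcongr
    have hs := Real.abs_sin_le_one (t * r * p)
    have hc := Real.abs_cos_le_one (t * r * p)
    have hrq : r ^ (2*σ) = r ^ (2*σ-1) * r := by
      rw [← Real.rpow_add_one hr.ne']; ring_nf
    have hcoef : (ν/2) * r ^ (2*σ) / (r * p) = (ν/2) * r ^ (2*σ-1) * (1/p) := by
      rw [hrq]; field_simp
    have hmono : r ^ (2*σ-1) ≤ ρ ^ (2*σ-1) := Real.rpow_le_rpow hr.le hrρ (by linarith)
    have hle : (ν/2) * r ^ (2*σ-1) * (1/p) ≤ (ν/2) * ρ ^ (2*σ-1) * (1/p0) := by gcongr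
    have h0 : 0 ≤ (ν/2) * r ^ (2*σ-1) * (1/p) := by positivity
    calc |Real.cos (t * r * p) - (ν/2) * r ^ (2*σ) / (r * p) * Real.sin (t * r * p)|
        ≤ |Real.cos (t * r * p)| + |(ν/2) * r ^ (2*σ) / (r * p) * Real.sin (t * r * p)| := abs_sub _ _
      _ ≤ 1 + (ν/2) * ρ ^ (2*σ-1) * (1/p0) * 1 := by
        rw [hcoef, abs_mul, abs_of_nonneg h0]
        gcongr
      _ ≤ _ := by
        rw [add_div]
        have : 0 < 1 / p0 := by positivity
        have e : (ν/2) * ρ ^ (2*σ-1) * (1/p0) * 1 = (ν/2) * ρ ^ (2*σ-1) / p0 := by ring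
        linarith

lemma aux_phi (ν σ ρ : ℝ) (hν : 0 < ν) (hσ : 1/2 < σ)
    (hρ : ρ = (1/2) * (2/ν) ^ ((1:ℝ)/(2*σ - 1))) :
    0 < 1 - ν^2/4 * ρ ^ (4*σ - 2) := by
  have hs : 0 < 2*σ - 1 := by linarith
  have h1 : ρ ^ (2*σ-1) = (1/2:ℝ) ^ (2*σ-1) * (2/ν) := by
    rw [hρ, Real.mul_rpow (by positivity) (by positivity), ← Real.rpow_mul (by positivity),
      one_div_mul_cancel hs.ne', Real.rpow_one]
  have hρ0 : 0 < ρ := by rw [hρ]; positivity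
  have h2 : ρ ^ (4*σ-2) = (ρ ^ (2*σ-1))^2 := by
    rw [← Real.rpow_natCast, ← Real.rpow_mul hρ0.le]; push_cast; ring_nf
  have h3 : (1/2:ℝ) ^ (2*σ-1) < 1 := Real.rpow_lt_one (by norm_num) (by norm_num) hs
  have h4 : 0 < (1/2:ℝ) ^ (2*σ-1) := by positivity
  have h5 : ν^2/4 * ρ ^ (4*σ - 2) = ((1/2:ℝ) ^ (2*σ-1))^2 := by
    rw [h2, h1]; field_simp; norm_num
  rw [h5]; nlinarith

/-- radial integral -/
lemma aux_int (n : ℕ) (hn : 3 ≤ n) (ν σ a : ℝ) (hν : 0 < ν) (hσ : 1/2 < σ) (ha : -2 ≤ a) :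
    ∃ K : ℝ, 0 ≤ K ∧ ∀ s : ℝ, 0 < s →
      ∫⁻ ξ : EuclideanSpace ℝ (Fin n), ENNReal.ofReal (‖ξ‖ ^ a * Real.exp (-(ν * s) * ‖ξ‖ ^ (2*σ)))
        = ENNReal.ofReal (K * s ^ (-(a + n) / (2*σ))) := by
  have hn' : (3:ℝ) ≤ n := by exact_mod_cast hn
  haveI : Nonempty (Fin n) := ⟨⟨0, by omega⟩⟩
  have hG : 0 < Real.Gamma ((a + n) / (2*σ)) := Real.Gamma_pos_of_pos (div_pos (by linarith) (by linarith))
  refine ⟨n * (volume : Measure (EuclideanSpace ℝ (Fin n))).real (Metric.ball 0 1) *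
    (ν ^ (-(a + n) / (2*σ)) * (1 / (2*σ)) * Real.Gamma ((a + n) / (2*σ))), by positivity, ?_⟩
  intro s hs
  have key : ∀ y ∈ Set.Ioi (0:ℝ), y ^ (n - 1) • (y ^ a * Real.exp (-(ν * s) * y ^ (2*σ)))
      = y ^ (a + n - 1) * Real.exp (-(ν * s) * y ^ (2*σ)) := by
    intro y hy
    have hy : 0 < y := hy
    rw [smul_eq_mul, ← mul_assoc, ← Real.rpow_natCast, ← Real.rpow_add hy,
      Nat.cast_sub (by omega)]
    congr 2
    push_cast; ring
  have hint : Integrable (fun ξ : EuclideanSpace ℝ (Fin n) =>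
      ‖ξ‖ ^ a * Real.exp (-(ν * s) * ‖ξ‖ ^ (2*σ))) volume := by
    have := (integrable_fun_norm_addHaar (volume : Measure (EuclideanSpace ℝ (Fin n)))
      (f := fun y : ℝ => y ^ a * Real.exp (-(ν * s) * y ^ (2*σ)))).2
    apply this
    rw [finrank_euclideanSpace_fin]
    rw [integrableOn_congr_fun key measurableSet_Ioi]
    exact integrableOn_rpow_mul_exp_neg_mul_rpow (by linarith) (by linarith) (by positivity)
  rw [← ofReal_integral_eq_lintegral_ofReal hint (Filter.Eventually.of_forall fun ξ => by positivity)]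
  congr 1
  have h1 := integral_fun_norm_addHaar (volume : Measure (EuclideanSpace ℝ (Fin n)))
      (fun y : ℝ => y ^ a * Real.exp (-(ν * s) * y ^ (2*σ)))
  rw [h1, finrank_euclideanSpace_fin, setIntegral_congr_fun measurableSet_Ioi key,
    integral_rpow_mul_exp_neg_mul_rpow (by linarith) (by linarith) (by positivity),
    sub_add_cancel, Real.mul_rpow hν.le hs.le]
  simp only [nsmul_eq_mul, smul_eq_mul]
  ring

theorem stmt17 (n : ℕ) (hn : 3 ≤ n) (ν σ : ℝ) (hν : 0 < ν)
    (hσ : σ ∈ Set.Ioc (1/2 : ℝ) 1) (ℓ : ℕ) (hℓ : ℓ ≤ 1)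
    (k ktil : ℝ) (hk0 : 0 ≤ k) (hktil : 0 ≤ ktil) (hk : ktil ≤ k + ℓ)
    (ρ : ℝ) (hρ : ρ = (1/2) * (2/ν) ^ ((1:ℝ)/(2*σ - 1)))
    (φ : EuclideanSpace ℝ (Fin n) → ℝ)
    (hφ : ∀ ξ, φ ξ = Real.sqrt (1 - ν^2/4 * ‖ξ‖ ^ (4*σ - 2))) :
    ∃ C > 0, ∀ t : ℝ, 0 ≤ t → ∀ h : EuclideanSpace ℝ (Fin n) → ℂ, Measurable h →
      ∀ M : ℝ, (∀ ξ : EuclideanSpace ℝ (Fin n), ξ ≠ 0 → ‖ξ‖ ^ ktil * ‖h ξ‖ ≤ M) →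
      (∫⁻ ξ in {ξ : EuclideanSpace ℝ (Fin n) | 0 < ‖ξ‖ ∧ ‖ξ‖ ≤ ρ},
          ENNReal.ofReal (‖ξ‖ ^ (2*k) *
            |deriv^[ℓ] (fun s => Real.exp (-(ν/2) * s * ‖ξ‖ ^ (2*σ)) *
                Real.sin (s * ‖ξ‖ * φ ξ) / (‖ξ‖ * φ ξ)) t| ^ 2 * ‖h ξ‖ ^ 2)) ^ ((1:ℝ)/2)
        ≤ ENNReal.ofReal (C * (1 + t) ^
              (-(n:ℝ)/(4*σ) - ((ℓ:ℝ) + k - ktil - 1)/(2*σ)) * M) := by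
  have hσ1 := hσ.1
  have hρ0 : 0 < ρ := by rw [hρ]; positivity
  have hphi := aux_phi ν σ ρ hν hσ1 hρ
  set p0 := Real.sqrt (1 - ν^2/4 * ρ ^ (4*σ - 2)) with hp0
  have hp0pos : 0 < p0 := Real.sqrt_pos.2 hphi
  set C1 := 1 + (1 + (ν/2) * ρ ^ (2*σ-1)) / p0 with hC1
  have hC1pos : 0 < C1 := by positivity
  obtain ⟨K, hK, hKint⟩ := aux_int n hn ν σ (2 * ((ℓ:ℝ) + k - ktil - 1)) hν hσ1 (by linarith)
  set a := 2 * ((ℓ:ℝ) + k - ktil - 1) with ha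
  set B := C1 ^ 2 * Real.exp (ν * ρ ^ (2*σ)) with hB
  have hBpos : 0 < B := by positivity
  refine ⟨Real.sqrt (B * K) + 1, by positivity, ?_⟩
  intro t ht h hmeas M hM
  haveI : Nonempty (Fin n) := ⟨⟨0, by omega⟩⟩
  have hM0 : 0 ≤ M := by
    obtain ⟨ξ, hξ⟩ := exists_ne (0 : EuclideanSpace ℝ (Fin n))
    exact le_trans (by positivity) (hM ξ hξ)
  have hs : 0 < 1 + t := by linarith
  have hmeasS : MeasurableSet {ξ : EuclideanSpace ℝ (Fin n) | 0 < ‖ξ‖ ∧ ‖ξ‖ ≤ ρ} :=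
    (measurableSet_lt measurable_const measurable_norm).inter
      (measurableSet_le measurable_norm measurable_const)
  have hpt : ∀ ξ ∈ {ξ : EuclideanSpace ℝ (Fin n) | 0 < ‖ξ‖ ∧ ‖ξ‖ ≤ ρ},
      ENNReal.ofReal (‖ξ‖ ^ (2*k) *
            |deriv^[ℓ] (fun s => Real.exp (-(ν/2) * s * ‖ξ‖ ^ (2*σ)) *
                Real.sin (s * ‖ξ‖ * φ ξ) / (‖ξ‖ * φ ξ)) t| ^ 2 * ‖h ξ‖ ^ 2)
      ≤ ENNReal.ofReal (B * M ^ 2) *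
        ENNReal.ofReal (‖ξ‖ ^ a * Real.exp (-(ν * (1 + t)) * ‖ξ‖ ^ (2*σ))) := by
    rintro ξ ⟨hr, hrρ⟩
    have hpξ : p0 ≤ φ ξ := by
      rw [hφ, hp0]
      apply Real.sqrt_le_sqrt
      have : ‖ξ‖ ^ (4*σ-2) ≤ ρ ^ (4*σ-2) := Real.rpow_le_rpow hr.le hrρ (by linarith)
      gcongr
    have hb := aux_bound_s17 ν σ ‖ξ‖ ρ (φ ξ) p0 t hν hσ1 hr hrρ hp0pos hpξ ℓ hℓ
    rw [← hC1] at hb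
    have hMξ := hM ξ (norm_pos_iff.1 hr)
    set D := |deriv^[ℓ] (fun s => Real.exp (-(ν/2) * s * ‖ξ‖ ^ (2*σ)) *
                Real.sin (s * ‖ξ‖ * φ ξ) / (‖ξ‖ * φ ξ)) t|
    have hD0 : 0 ≤ D := abs_nonneg _
    generalize ‖ξ‖ = r at *
    generalize hH : ‖h ξ‖ = H at *
    have hH0 : 0 ≤ H := hH ▸ norm_nonneg _
    rw [← ENNReal.ofReal_mul (by positivity)]
    apply ENNReal.ofReal_le_ofReal
    have hHle : H ≤ M * r ^ (-ktil) := by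
      rw [Real.rpow_neg hr.le, ← div_eq_mul_inv, le_div_iff₀ (by positivity)]
      linarith
    have hsq : ∀ x : ℝ, (r ^ x) ^ 2 = r ^ (2 * x) := fun x => by
      rw [← Real.rpow_natCast, ← Real.rpow_mul hr.le]; push_cast; ring_nf
    have hee : Real.exp (-(ν/2) * t * r ^ (2*σ)) ^ 2
        ≤ Real.exp (ν * ρ ^ (2*σ)) * Real.exp (-(ν * (1 + t)) * r ^ (2*σ)) := by
      rw [← Real.exp_nat_mul, ← Real.exp_add]
      apply Real.exp_le_exp.2
      have : r ^ (2*σ) ≤ ρ ^ (2*σ) := Real.rpow_le_rpow hr.le hrρ (by linarith)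
      push_cast
      nlinarith
    have hpow : r ^ (2*k) * (r ^ (2 * ((ℓ:ℝ) - 1)) * r ^ (2 * (-ktil))) = r ^ a := by
      rw [← Real.rpow_add hr, ← Real.rpow_add hr, ha]; ring_nf
    calc r ^ (2*k) * D ^ 2 * H ^ 2
        ≤ r ^ (2*k) * (C1 * (Real.exp (-(ν/2) * t * r ^ (2*σ)) * r ^ ((ℓ:ℝ) - 1))) ^ 2
            * (M * r ^ (-ktil)) ^ 2 := by gcongr
      _ = C1 ^ 2 * M ^ 2 * (r ^ (2*k) * (r ^ (2 * ((ℓ:ℝ) - 1)) * r ^ (2 * (-ktil)))) *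
            Real.exp (-(ν/2) * t * r ^ (2*σ)) ^ 2 := by
          rw [← hsq ((ℓ:ℝ) - 1), ← hsq (-ktil)]; ring
      _ ≤ C1 ^ 2 * M ^ 2 * r ^ a *
            (Real.exp (ν * ρ ^ (2*σ)) * Real.exp (-(ν * (1 + t)) * r ^ (2*σ))) := by
          rw [hpow]; gcongr
      _ = _ := by rw [hB]; ring
  have hI := (setLIntegral_mono' (μ := volume) hmeasS hpt).trans (setLIntegral_le_lintegral _ _)
  rw [lintegral_const_mul' _ _ ENNReal.ofReal_ne_top, hKint _ hs,
    ← ENNReal.ofReal_mul (by positivity)] at hI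
  set e := -(n:ℝ)/(4*σ) - ((ℓ:ℝ) + k - ktil - 1)/(2*σ) with he
  have hee : (1 + t) ^ (-(a + n) / (2*σ)) = ((1 + t) ^ e) ^ 2 := by
    rw [← Real.rpow_natCast, ← Real.rpow_mul hs.le]
    congr 1
    have : σ ≠ 0 := by linarith
    rw [he, ha]; push_cast; field_simp; ring
  have hY : 0 ≤ Real.sqrt (B * K) * (1 + t) ^ e * M := by positivity
  calc _ ≤ (ENNReal.ofReal ((Real.sqrt (B * K) * (1 + t) ^ e * M) ^ 2)) ^ ((1:ℝ)/2) := by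
        apply ENNReal.rpow_le_rpow (hI.trans _) (by norm_num)
        apply ENNReal.ofReal_le_ofReal
        rw [hee, mul_pow, mul_pow, Real.sq_sqrt (by positivity)]
        apply le_of_eq; ring
    _ = ENNReal.ofReal (Real.sqrt (B * K) * (1 + t) ^ e * M) := by
        rw [ENNReal.ofReal_rpow_of_nonneg (by positivity) (by norm_num), ← Real.sqrt_eq_rpow,
          Real.sqrt_sq hY]
    _ ≤ _ := by
        apply ENNReal.ofReal_le_ofReal
        gcongr
        linarith
end
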